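/- arXiv:2201.01339 — 3 statements merged into one kernel-verified Lean document; each statement's English description precedes it below -/
import Mathlib

section
/- In the Loidreau–Overbeck setting, assume rk_F(λ_(n−t−k)(E)_a⃗) = t, and let h = (h^(1) | ⋯ | h^(ℓ)) ∈ F^n be any nonzero vector with L·hᵀ = 0. Then rk_q(h^(i)) = n_i − t_i for every i = 1, …, ℓ; in particular the sum-rank weight of h is wt_ΣR(h) = n − t. -/
namespace Stmt6

/-- `genNorm σ a i = σ^(i-1)(a) ⋯ σ(a) · a`, the generalized power function `N_i(a)`. -/
def genNorm {F : Type} [Field F] (σ : F ≃+* F) (a : F) : ℕ → F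
  | 0 => 1
  | i + 1 => (⇑σ)^[i] a * genNorm σ a i

/-- Generalized operator `D_a^i(b) = σ^i(b) · N_i(a)` for `i ∈ ℕ`. -/
def opev {F : Type} [Field F] (σ : F ≃+* F) (a b : F) (i : ℕ) : F :=
  (⇑σ)^[i] b * genNorm σ a i

/-- `b` is σ-conjugate to `a`, i.e. `b = σ(c)·a·c⁻¹` for some nonzero `c`. -/
def SConj {F : Type} [Field F] (σ : F ≃+* F) (a b : F) : Prop :=
  ∃ c : F, c ≠ 0 ∧ b = σ c * a * c⁻¹

/-- σ-generalized Moore matrix `λ_d(x)_a⃗` w.r.t. the length partition `nn`: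
its row `r` applies `D_{a_i}^r` entrywise to the `i`-th block of `x`. -/
def moore {F : Type} [Field F] (σ : F ≃+* F) {ℓ : ℕ} (nn : Fin ℓ → ℕ) (aa : Fin ℓ → F)
    (d : ℕ) (x : (Σ i : Fin ℓ, Fin (nn i)) → F) :
    Matrix (Fin d) (Σ i : Fin ℓ, Fin (nn i)) F :=
  Matrix.of fun r p => opev σ (aa p.1) (x p) (r : ℕ)

/-- `λ_d(X)_a⃗` for a matrix `X`: the stack of `λ_d(x_j)_a⃗` over the rows of `X`. -/
def mooreMat {F : Type} [Field F] (σ : F ≃+* F) {ℓ : ℕ} (nn : Fin ℓ → ℕ) (aa : Fin ℓ → F)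
    {s : ℕ} (d : ℕ) (X : Matrix (Fin s) (Σ i : Fin ℓ, Fin (nn i)) F) :
    Matrix (Fin s × Fin d) (Σ i : Fin ℓ, Fin (nn i)) F :=
  Matrix.of fun r p => opev σ (aa p.1) (X r.1 p) (r.2 : ℕ)

/-- `rk_q` of a vector: the `K`-dimension of the `K`-span of its entries. -/
noncomputable def rkq (K : Type) [Field K] {F : Type} [Field F] [Algebra K F] {ι : Type}
    (v : ι → F) : ℕ :=
  Module.finrank K (Submodule.span K (Set.range v))

/-- `rk_q` of a matrix: the `K`-dimension of the `K`-span of its columns. -/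
noncomputable def rkqMat (K : Type) [Field K] {F : Type} [Field F] [Algebra K F]
    {s : ℕ} {ι : Type} (X : Matrix (Fin s) ι F) : ℕ :=
  Module.finrank K (Submodule.span K (Set.range fun j : ι => fun r : Fin s => X r j))

/-- Sum-rank weight of a blockwise vector. -/
noncomputable def wtV (K : Type) [Field K] {F : Type} [Field F] [Algebra K F] {ℓ : ℕ}
    (nn : Fin ℓ → ℕ) (x : (Σ i : Fin ℓ, Fin (nn i)) → F) : ℕ :=
  ∑ i, rkq K fun μ : Fin (nn i) => x ⟨i, μ⟩

/-- Sum-rank weight of a blockwise matrix. -/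
noncomputable def wtM (K : Type) [Field K] {F : Type} [Field F] [Algebra K F] {s ℓ : ℕ}
    (nn : Fin ℓ → ℕ) (X : Matrix (Fin s) (Σ i : Fin ℓ, Fin (nn i)) F) : ℕ :=
  ∑ i, rkqMat K (Matrix.of fun (r : Fin s) (μ : Fin (nn i)) => X r ⟨i, μ⟩)

/-- Codeword `C(M) = M · λ_k(β)_a⃗` of the `s`-interleaved linearized Reed–Solomon code. -/
def codeword {F : Type} [Field F] (σ : F ≃+* F) {ℓ : ℕ} (nn : Fin ℓ → ℕ) (aa : Fin ℓ → F)
    (β : (Σ i : Fin ℓ, Fin (nn i)) → F) {s : ℕ} (k : ℕ) (M : Matrix (Fin s) (Fin k) F) :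
    Matrix (Fin s) (Σ i : Fin ℓ, Fin (nn i)) F :=
  M * moore σ nn aa k β

/-- Loidreau–Overbeck decoding matrix: the stack of `λ_{n-t-1}(β)_a⃗` and
`λ_{n-t-k}(r_j)_a⃗` for the rows `r_j` of `R`. -/
def LOmat {F : Type} [Field F] (σ : F ≃+* F) {ℓ : ℕ} (nn : Fin ℓ → ℕ) (aa : Fin ℓ → F)
    (β : (Σ i : Fin ℓ, Fin (nn i)) → F) {s : ℕ}
    (R : Matrix (Fin s) (Σ i : Fin ℓ, Fin (nn i)) F) (n t k : ℕ) :
    Matrix (Fin (n - t - 1) ⊕ Fin s × Fin (n - t - k)) (Σ i : Fin ℓ, Fin (nn i)) F :=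
  Matrix.of fun r p =>
    match r with
    | Sum.inl u => opev σ (aa p.1) (β p) (u : ℕ)
    | Sum.inr ju => opev σ (aa p.1) (R ju.1 p) (ju.2 : ℕ)

section Operators

variable {K F : Type} [Field K] [Field F] [Algebra K F] (σ : F ≃+* F)

theorem map_smul_of_fixed (hfix : ∀ x : F, σ x = x ↔ x ∈ Set.range (algebraMap K F))
    (g : K) (x : F) : σ (g • x) = g • σ x := by
  rw [Algebra.smul_def, Algebra.smul_def, map_mul, (hfix _).2 ⟨g, rfl⟩]

theorem iterate_map_mul (i : ℕ) (x y : F) : (⇑σ)^[i] (x * y) = (⇑σ)^[i] x * (⇑σ)^[i] y := by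
  induction i generalizing x y with
  | zero => rfl
  | succ i ih => simp only [Function.iterate_succ_apply, map_mul, ih]

theorem map_genNorm (a : F) (i : ℕ) : a * σ (genNorm σ a i) = genNorm σ a (i + 1) := by
  induction i with
  | zero => simp [genNorm]
  | succ i ih =>
    rw [genNorm, map_mul, mul_left_comm, ih, genNorm, ← Function.iterate_succ_apply' (⇑σ) i a,
      genNorm, genNorm]

theorem opev_zero (a b : F) : opev σ a b 0 = b := by simp [opev, genNorm]

theorem opev_succ (a b : F) (i : ℕ) : opev σ a b (i + 1) = opev σ a (σ b * a) i := by
  simp only [opev, genNorm, iterate_map_mul, Function.iterate_succ_apply]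
  ring

theorem mul_map_opev (a b : F) (i : ℕ) : a * σ (opev σ a b i) = opev σ a b (i + 1) := by
  rw [opev, opev, map_mul, mul_left_comm, map_genNorm, Function.iterate_succ_apply']

theorem opev_opev (a b : F) (i j : ℕ) : opev σ a (opev σ a b j) i = opev σ a b (i + j) := by
  induction i with
  | zero => simp [opev_zero]
  | succ i ih => rw [← mul_map_opev, ih, mul_map_opev]; congr 1; omega

theorem opev_add (a x y : F) (i : ℕ) : opev σ a (x + y) i = opev σ a x i + opev σ a y i := by
  induction i generalizing x y with
  | zero => simp [opev_zero]
  | succ i ih => simp only [opev_succ, map_add, add_mul, ih]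

theorem opev_mul (a m x : F) (i : ℕ) : opev σ a (m * x) i = (⇑σ)^[i] m * opev σ a x i := by
  simp only [opev, iterate_map_mul, mul_assoc]

theorem opev_sum {ι : Type} (a : F) (s : Finset ι) (x : ι → F) (i : ℕ) :
    opev σ a (∑ j ∈ s, x j) i = ∑ j ∈ s, opev σ a (x j) i :=
  map_sum (AddMonoidHom.mk' (fun y => opev σ a y i) fun y z => opev_add σ a y z i) x s

variable {σ}

theorem opev_smul (hσ : ∀ (g : K) (x : F), σ (g • x) = g • σ x) (a : F) (g : K) (x : F) (i : ℕ) :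
    opev σ a (g • x) i = g • opev σ a x i := by
  induction i generalizing x with
  | zero => simp [opev_zero]
  | succ i ih => rw [opev_succ, opev_succ, hσ, smul_mul_assoc, ih]

/-- The columns of a square generalized Moore matrix are linearly independent when its entries are
`K`-linearly independent within each block and the evaluation parameters are nonzero and pairwise
non-σ-conjugate. -/
theorem eq_zero_of_sum_mul_opev_eq_zero
    (hfix : ∀ x : F, σ x = x ↔ x ∈ Set.range (algebraMap K F))
    {ι κ : Type} (aa : κ → F) (ha0 : ∀ i, aa i ≠ 0)
    (haconj : ∀ i j : κ, i ≠ j → ¬ SConj σ (aa i) (aa j)) (b : ι → κ) (I : Finset ι)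
    (x : ι → F) (hx : ∀ i, LinearIndepOn K x {p | p ∈ I ∧ b p = i}) (c : ι → F)
    (hc : ∀ r < I.card, ∑ p ∈ I, c p * opev σ (aa (b p)) (x p) r = 0) :
    ∀ p ∈ I, c p = 0 := by
  classical
  induction I using Finset.induction_on generalizing x c with
  | empty => simp
  | insert p₀ J hp₀ ih =>
    rw [Finset.card_insert_of_notMem hp₀] at hc
    have hsub : ∀ i, {p | p ∈ J ∧ b p = i} ⊆ {p | p ∈ insert p₀ J ∧ b p = i} :=
      fun i p hp => ⟨Finset.mem_insert_of_mem hp.1, hp.2⟩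
    by_cases h0 : c p₀ = 0
    · have := ih x (fun i => (hx i).mono (hsub i)) c fun r hr => by
        simpa [Finset.sum_insert hp₀, h0] using hc r (by omega)
      simpa [h0] using this
    exfalso
    -- `d` is a relation between the shifted columns that does not involve `p₀`
    set d : ι → F := fun p =>
      c p * (σ (c p₀) * (aa (b p₀))⁻¹) - σ (c p) * (aa (b p))⁻¹ * c p₀ with hd
    have hd0 : ∀ p ∈ J, d p = 0 := by
      refine ih (fun p => σ (x p) * aa (b p)) (fun i => ?_) d fun r hr => ?_
      · let f : F →ₗ[K] F :=
          { toFun := fun y => σ y * aa i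
            map_add' := fun y z => by simp [add_mul]
            map_smul' := fun g y => by simp [map_smul_of_fixed σ hfix] }
        have hf : Function.Injective f := fun y z hyz =>
          σ.injective (mul_right_cancel₀ (ha0 i) hyz)
        have := ((hx i).mono (hsub i)).map_injOn f hf.injOn
        refine this.congr fun p hp => ?_
        simp only [Function.comp_apply, f, LinearMap.coe_mk, AddHom.coe_mk]
        rw [hp.2]
      · have h1 := hc (r + 1) (by omega)
        have h2 := congrArg σ (hc r (by omega))
        rw [map_sum, map_zero] at h2
        have h2' : ∑ p ∈ insert p₀ J,
            σ (c p) * (aa (b p))⁻¹ * opev σ (aa (b p)) (x p) (r + 1) = 0 := by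
          rw [← h2]
          refine Finset.sum_congr rfl fun p _ => ?_
          rw [← mul_map_opev, map_mul]
          field_simp [ha0 (b p)]
        have h3 : ∑ p ∈ insert p₀ J, d p * opev σ (aa (b p)) (x p) (r + 1) = 0 := by
          have : ∑ p ∈ insert p₀ J, d p * opev σ (aa (b p)) (x p) (r + 1) =
              (∑ p ∈ insert p₀ J, c p * opev σ (aa (b p)) (x p) (r + 1)) *
                (σ (c p₀) * (aa (b p₀))⁻¹) -
              (∑ p ∈ insert p₀ J,
                σ (c p) * (aa (b p))⁻¹ * opev σ (aa (b p)) (x p) (r + 1)) * c p₀ := by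
            rw [Finset.sum_mul, Finset.sum_mul, ← Finset.sum_sub_distrib]
            refine Finset.sum_congr rfl fun p _ => ?_
            simp only [hd]; ring
          rw [this, h1, h2', zero_mul, zero_mul, sub_zero]
        rw [Finset.sum_insert hp₀] at h3
        have hdp : d p₀ = 0 := by simp only [hd]; ring
        rw [hdp, zero_mul, zero_add] at h3
        simpa only [opev_succ] using h3
    have hdI : ∀ p ∈ insert p₀ J, d p = 0 := by
      intro p hp
      rcases Finset.mem_insert.1 hp with rfl | hp
      · simp only [hd]; ring
      · exact hd0 p hp
    have hσ0 : σ (c p₀) ≠ 0 := (map_ne_zero σ).2 h0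
    have hblk : ∀ p ∈ insert p₀ J, c p ≠ 0 → b p = b p₀ := by
      intro p hp hcp
      by_contra hne
      refine haconj (b p₀) (b p) (Ne.symm hne) ⟨c p / c p₀, div_ne_zero hcp h0, ?_⟩
      have := hdI p hp
      have h1 := ha0 (b p)
      have h2 := ha0 (b p₀)
      simp only [hd] at this
      rw [map_div₀]
      field_simp at this ⊢
      linear_combination this
    have hK : ∀ p, ∃ g : K, p ∈ insert p₀ J → c p = g • c p₀ := by
      intro p
      by_cases hp : p ∈ insert p₀ J
      swap
      · exact ⟨0, fun h => absurd h hp⟩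
      by_cases hcp : c p = 0
      · exact ⟨0, fun _ => by simp [hcp]⟩
      have hfx : σ (c p / c p₀) = c p / c p₀ := by
        have := hdI p hp
        have h2 := ha0 (b p₀)
        simp only [hd, hblk p hp hcp] at this
        rw [map_div₀]
        field_simp at this ⊢
        linear_combination -this
      obtain ⟨g, hg⟩ := (hfix _).1 hfx
      refine ⟨g, fun _ => ?_⟩
      rw [Algebra.smul_def, hg, div_mul_cancel₀ _ h0]
    choose g hg using hK
    have hzero := hc 0 (by omega)
    simp only [opev_zero] at hzero
    have hg0 : ∀ p ∈ insert p₀ J, b p ≠ b p₀ → g p = 0 := by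
      intro p hp hne
      by_contra hgp
      refine hne (hblk p hp ?_)
      rw [hg p hp]
      exact smul_ne_zero hgp h0
    have hsum : ∑ p ∈ (insert p₀ J).filter (fun p => b p = b p₀), g p • x p = 0 := by
      rw [Finset.sum_filter_of_ne]
      · refine mul_left_cancel₀ h0 ?_
        rw [mul_zero, ← hzero, Finset.mul_sum]
        refine Finset.sum_congr rfl fun p hp => ?_
        rw [hg p hp, mul_smul_comm, smul_mul_assoc]
      · intro p hp hne
        by_contra hb
        exact hne (by rw [hg0 p hp hb, zero_smul])
    have hx' : LinearIndepOn K x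
        ((insert p₀ J).filter (fun p => b p = b p₀) : Finset ι) :=
      (hx (b p₀)).mono fun p hp => by simpa using hp
    have := linearIndepOn_finset_iff.1 hx' g hsum p₀ (by simp)
    exact h0 (by rw [hg p₀ (by simp), this, zero_smul])

end Operators

/-- Rank factorization of a finite family of vectors. -/
theorem exists_rank_factorization {K V ι : Type} [Field K] [AddCommGroup V] [Module K V]
    [Module.Finite K V] (v : ι → V) {m : ℕ}
    (hm : Module.finrank K (Submodule.span K (Set.range v)) = m) :
    ∃ (c : Fin m → V) (P : Fin m → ι → K),
      LinearIndependent K P ∧ ∀ j, v j = ∑ ν, P ν j • c ν := by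
  subst hm
  set W := Submodule.span K (Set.range v) with hW
  let B := Module.finBasis K W
  have hv : ∀ j, v j ∈ W := fun j => Submodule.subset_span ⟨j, rfl⟩
  refine ⟨fun ν => B ν, fun ν j => B.repr ⟨v j, hv j⟩ ν, ?_, fun j => ?_⟩
  · rw [Fintype.linearIndependent_iff]
    intro g hg
    let φ : W →ₗ[K] K := B.constr K g
    have hφ : ∀ w : W, φ w = ∑ ν, g ν * B.repr w ν := fun w => by
      simp [φ, Module.Basis.constr_apply_fintype, mul_comm]
    have hspan : ∀ (w : V) (hw : w ∈ W), φ ⟨w, hw⟩ = 0 := by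
      intro w hw
      induction hw using Submodule.span_induction with
      | mem y hy =>
        obtain ⟨j, rfl⟩ := hy
        rw [hφ]
        simpa using congrFun hg j
      | zero => exact map_zero φ
      | add y z hy hz h1 h2 =>
        have := map_add φ ⟨y, hy⟩ ⟨z, hz⟩
        rw [h1, h2, add_zero] at this
        exact this
      | smul a y hy h1 =>
        have := map_smul φ a ⟨y, hy⟩
        rw [h1, smul_zero] at this
        exact this
    intro ν
    have : φ (B ν) = g ν := B.constr_basis K g ν
    rw [← this]
    exact hspan (B ν) (B ν).2
  · have := congrArg W.subtype (B.sum_repr ⟨v j, hv j⟩)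
    rw [map_sum] at this
    exact this.symm

/-- A family annihilated by `m` independent coefficient vectors spans a space of codimension at
least `m` in the number of its members. -/
theorem finrank_span_add_le_of_annihilated {K V ι : Type} [Field K] [AddCommGroup V] [Module K V]
    [Fintype ι] (v : ι → V) {m : ℕ} (P : Fin m → ι → K)
    (hP : LinearIndependent K P) (hPv : ∀ ν, ∑ j, P ν j • v j = 0) :
    Module.finrank K (Submodule.span K (Set.range v)) + m ≤ Fintype.card ι := by
  have h1 := LinearMap.finrank_range_add_finrank_ker (Fintype.linearCombination K v)
  rw [Fintype.range_linearCombination, Module.finrank_fintype_fun_eq_card] at h1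
  have h2 : Submodule.span K (Set.range P) ≤ LinearMap.ker (Fintype.linearCombination K v) := by
    rw [Submodule.span_le]
    rintro _ ⟨ν, rfl⟩
    simpa [Fintype.linearCombination_apply] using hPv ν
  have h3 := Submodule.finrank_mono h2
  rw [finrank_span_eq_card hP, Fintype.card_fin] at h3
  omega

section SumRank

variable {K F : Type} [Field K] [Field F] [Algebra K F] [Module.Finite K F] {σ : F ≃+* F}
  {ℓ : ℕ} {nn : Fin ℓ → ℕ} {aa : Fin ℓ → F}

/-- The code with parity-check matrix `λ_d(β)_a⃗` has minimum sum-rank distance exceeding `d`. -/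
theorem lt_wtV_of_moore_mulVec_eq_zero
    (hfix : ∀ x : F, σ x = x ↔ x ∈ Set.range (algebraMap K F))
    (ha0 : ∀ i, aa i ≠ 0)
    (haconj : ∀ i j : Fin ℓ, i ≠ j → ¬ SConj σ (aa i) (aa j))
    (β : (Σ i : Fin ℓ, Fin (nn i)) → F)
    (hβ : ∀ i, LinearIndependent K fun μ : Fin (nn i) => β ⟨i, μ⟩)
    (h : (Σ i : Fin ℓ, Fin (nn i)) → F) (hh0 : h ≠ 0) {d : ℕ}
    (hker : ∀ r < d, ∑ p, opev σ (aa p.1) (β p) r * h p = 0) :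
    d < wtV K nn h := by
  by_contra! hle
  have hσ := map_smul_of_fixed σ hfix
  let w : Fin ℓ → ℕ := fun i => rkq K fun μ : Fin (nn i) => h ⟨i, μ⟩
  choose c P hP hc using fun i =>
    exists_rank_factorization (K := K) (fun μ : Fin (nn i) => h ⟨i, μ⟩) (m := w i) rfl
  let y : (Σ i : Fin ℓ, Fin (w i)) → F := fun p => ∑ μ, P p.1 p.2 μ • β ⟨p.1, μ⟩
  have hy : ∀ i, LinearIndependent K fun ν : Fin (w i) => y ⟨i, ν⟩ := fun i =>
    (hP i).map' (Fintype.linearCombination K fun μ : Fin (nn i) => β ⟨i, μ⟩)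
      (LinearMap.ker_eq_bot.2 (hβ i).fintypeLinearCombination_injective)
  have key := eq_zero_of_sum_mul_opev_eq_zero hfix aa ha0 haconj
    (Sigma.fst : (Σ i : Fin ℓ, Fin (w i)) → Fin ℓ) Finset.univ y (fun i => ?_)
    (fun p => c p.1 p.2) (fun r hr => ?_)
  · refine hh0 (funext fun p => ?_)
    obtain ⟨i, μ⟩ := p
    rw [hc i μ]
    refine Finset.sum_eq_zero fun ν _ => ?_
    rw [key ⟨i, ν⟩ (Finset.mem_univ _), smul_zero]
  · have hset : {p : Σ i : Fin ℓ, Fin (w i) | p ∈ Finset.univ ∧ p.1 = i} =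
        Set.range (fun ν : Fin (w i) => (⟨i, ν⟩ : Σ i : Fin ℓ, Fin (w i))) := by
      ext ⟨j, ν⟩
      constructor
      · rintro ⟨_, rfl⟩
        exact ⟨ν, rfl⟩
      · rintro ⟨ν', h'⟩
        exact ⟨Finset.mem_univ _, (congrArg Sigma.fst h').symm⟩
    rw [hset, linearIndepOn_range_iff sigma_mk_injective]
    exact hy i
  · have hcard : (Finset.univ : Finset (Σ i : Fin ℓ, Fin (w i))).card = wtV K nn h := by
      simp [w, wtV]
    rw [hcard] at hr
    rw [← hker r (by omega), Fintype.sum_sigma, Fintype.sum_sigma]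
    refine Finset.sum_congr rfl fun i _ => ?_
    simp only [hc i, y, opev_sum, opev_smul hσ, Finset.mul_sum]
    rw [Finset.sum_comm]
    refine Finset.sum_congr rfl fun μ _ => Finset.sum_congr rfl fun ν _ => ?_
    rw [mul_smul_comm, mul_smul_comm, mul_comm]

/-- If the generalized Moore matrix of `E` attains rank `wt_ΣR(E)`, then every vector in its right
kernel has blockwise `rk_q` bounded by the corank of the blocks of `E`. -/
theorem rkq_add_rkqMat_le_of_mooreMat_mulVec_eq_zero
    (hfix : ∀ x : F, σ x = x ↔ x ∈ Set.range (algebraMap K F)) {s d : ℕ}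
    (E : Matrix (Fin s) (Σ i : Fin ℓ, Fin (nn i)) F)
    (hrk : (mooreMat σ nn aa d E).rank = wtM K nn E)
    (h : (Σ i : Fin ℓ, Fin (nn i)) → F)
    (hker : (mooreMat σ nn aa d E).mulVec h = 0) (i : Fin ℓ) :
    rkq K (fun μ : Fin (nn i) => h ⟨i, μ⟩) +
      rkqMat K (Matrix.of fun (r : Fin s) (μ : Fin (nn i)) => E r ⟨i, μ⟩) ≤ nn i := by
  have hσ := map_smul_of_fixed σ hfix
  let τ : Fin ℓ → ℕ := fun i =>
    rkqMat K (Matrix.of fun (r : Fin s) (μ : Fin (nn i)) => E r ⟨i, μ⟩)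
  choose A B hB hA using fun i =>
    exists_rank_factorization (K := K) (fun (μ : Fin (nn i)) (r : Fin s) => E r ⟨i, μ⟩)
      (m := τ i) rfl
  let A' : Matrix (Fin s) (Σ i : Fin ℓ, Fin (τ i)) F := Matrix.of fun r p => A p.1 p.2 r
  have hτ : Fintype.card (Σ i : Fin ℓ, Fin (τ i)) = wtM K nn E := by simp [τ, wtM]
  have hτi : rkqMat K (Matrix.of fun (r : Fin s) (μ : Fin (nn i)) => E r ⟨i, μ⟩) = τ i := rfl
  rw [hτi]
  clear_value τ
  let B' : Matrix (Σ i : Fin ℓ, Fin (τ i)) (Σ i : Fin ℓ, Fin (nn i)) F :=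
    Matrix.blockDiagonal' fun i => Matrix.of fun ν μ => algebraMap K F (B i ν μ)
  have hfac : mooreMat σ nn aa d E = mooreMat σ τ aa d A' * B' := by
    ext r ⟨j, μ⟩
    rw [Matrix.mul_apply, Fintype.sum_sigma, Finset.sum_eq_single j]
    · have hE : E r.1 ⟨j, μ⟩ = ∑ ν, B j ν μ • A j ν r.1 := by
        simpa using congrFun (hA j μ) r.1
      simp only [mooreMat, Matrix.of_apply, hE, opev_sum, opev_smul hσ]
      refine Finset.sum_congr rfl fun ν _ => ?_
      simp only [B', A', Matrix.blockDiagonal'_apply_eq, Matrix.of_apply]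
      rw [Algebra.smul_def, mul_comm]
    · intro j' _ hne
      refine Finset.sum_eq_zero fun ν _ => ?_
      exact mul_eq_zero_of_right _ (Matrix.blockDiagonal'_apply_ne _ _ _ hne)
    · simp
  have hinj : Function.Injective (mooreMat σ τ aa d A').mulVec := by
    have h1 : wtM K nn E ≤ (mooreMat σ τ aa d A').rank := by
      rw [← hrk, hfac]
      exact Matrix.rank_mul_le_left _ _
    have h2 := LinearMap.finrank_range_add_finrank_ker (mooreMat σ τ aa d A').mulVecLin
    rw [Module.finrank_fintype_fun_eq_card, hτ] at h2
    rw [Matrix.rank] at h1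
    have h4 : Module.finrank F (LinearMap.ker (mooreMat σ τ aa d A').mulVecLin) = 0 := by omega
    rw [Submodule.finrank_eq_zero, LinearMap.ker_eq_bot] at h4
    exact h4
  have hBh : B'.mulVec h = 0 := by
    apply hinj
    rw [Matrix.mulVec_mulVec, ← hfac, hker, Matrix.mulVec_zero]
  have := finrank_span_add_le_of_annihilated (fun μ : Fin (nn i) => h ⟨i, μ⟩) (B i) (hB i)
    fun ν => by
      have h1 := congrFun hBh ⟨i, ν⟩
      rw [Matrix.mulVec, dotProduct, Fintype.sum_sigma, Finset.sum_eq_single i] at h1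
      · simpa [B', Matrix.blockDiagonal'_apply_eq, Algebra.smul_def] using h1
      · intro j _ hne
        refine Finset.sum_eq_zero fun μ _ => ?_
        exact mul_eq_zero_of_left (Matrix.blockDiagonal'_apply_ne _ _ _ hne.symm) _
      · simp
  simpa only [rkq, Fintype.card_fin] using this

/-- Annihilating `λ_{n-t-1}(β)` and `λ_{n-t-k}(R)` forces annihilation of `λ_{n-t-k}(E)`. -/
theorem mooreMat_mulVec_eq_zero_of_LOmat {s k n t : ℕ} (β : (Σ i : Fin ℓ, Fin (nn i)) → F)
    (M : Matrix (Fin s) (Fin k) F) (E : Matrix (Fin s) (Σ i : Fin ℓ, Fin (nn i)) F)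
    (h : (Σ i : Fin ℓ, Fin (nn i)) → F)
    (hβh : ∀ r < n - t - 1, ∑ p, opev σ (aa p.1) (β p) r * h p = 0)
    (hker : (LOmat σ nn aa β (codeword σ nn aa β k M + E) n t k).mulVec h = 0) :
    (mooreMat σ nn aa (n - t - k) E).mulVec h = 0 := by
  ext ⟨j, u⟩
  have h1 := congrFun hker (Sum.inr (j, u))
  simp only [Matrix.mulVec, dotProduct, LOmat, mooreMat, Matrix.of_apply, Matrix.add_apply,
    opev_add, add_mul, Finset.sum_add_distrib, Pi.zero_apply] at h1 ⊢
  rw [← h1, right_eq_add]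
  simp only [codeword, Matrix.mul_apply, moore, Matrix.of_apply, opev_sum, opev_mul, opev_opev,
    Finset.sum_mul]
  rw [Finset.sum_comm]
  refine Finset.sum_eq_zero fun l _ => ?_
  simp only [mul_assoc]
  rw [← Finset.mul_sum, hβh _ (by omega), mul_zero]

end SumRank

/-- If `rk_F(λ_{n−t−k}(E)_a⃗) = t` and `h ≠ 0` lies in the right kernel of the decoding
matrix `L`, then `rk_q(h^(i)) = n_i − t_i` for every `i`, and `wt_ΣR(h) = n − t`. -/
theorem LO_kernel_element
    {K F : Type} [Field K] [Field F] [Algebra K F] [Fintype K] [Fintype F]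
    (σ : F ≃+* F)
    (hfix : ∀ x : F, σ x = x ↔ x ∈ Set.range (algebraMap K F))
    {ℓ : ℕ} (hℓ : 1 ≤ ℓ) (nn : Fin ℓ → ℕ) (aa : Fin ℓ → F)
    (ha0 : ∀ i, aa i ≠ 0)
    (haconj : ∀ i j : Fin ℓ, i ≠ j → ¬ SConj σ (aa i) (aa j))
    (β : (Σ i : Fin ℓ, Fin (nn i)) → F)
    (hβ : ∀ i, LinearIndependent K fun μ : Fin (nn i) => β ⟨i, μ⟩)
    {s : ℕ} (hs : 1 ≤ s) {k n t : ℕ} (hn : n = ∑ i, nn i)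
    (hk : 1 ≤ k) (hkn : k ≤ n)
    (M : Matrix (Fin s) (Fin k) F)
    (E R : Matrix (Fin s) (Σ i : Fin ℓ, Fin (nn i)) F)
    (hR : R = codeword σ nn aa β k M + E)
    (ht : wtM K nn E = t) (htnk : t ≤ n - k)
    (hrk : (mooreMat σ nn aa (n - t - k) E).rank = t)
    (h : (Σ i : Fin ℓ, Fin (nn i)) → F) (hh0 : h ≠ 0)
    (hker : (LOmat σ nn aa β R n t k).mulVec h = 0) :
    (∀ i : Fin ℓ,
        rkq K (fun μ : Fin (nn i) => h ⟨i, μ⟩)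
          = nn i - rkqMat K (Matrix.of fun (r : Fin s) (μ : Fin (nn i)) => E r ⟨i, μ⟩)) ∧
      wtV K nn h = n - t := by
  subst hR
  have hβh : ∀ r < n - t - 1, ∑ p, opev σ (aa p.1) (β p) r * h p = 0 := fun r hr =>
    congrFun hker (Sum.inl ⟨r, hr⟩)
  have hlow := lt_wtV_of_moore_mulVec_eq_zero hfix ha0 haconj β hβ h hh0 hβh
  have hup := rkq_add_rkqMat_le_of_mooreMat_mulVec_eq_zero hfix E (hrk.trans ht.symm) h
    (mooreMat_mulVec_eq_zero_of_LOmat β M E h hβh hker)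
  have hsum : wtV K nn h + wtM K nn E ≤ n := by
    rw [hn, wtV, wtM, ← Finset.sum_add_distrib]
    exact Finset.sum_le_sum fun i _ => hup i
  have hwt : wtV K nn h + wtM K nn E = n := by omega
  refine ⟨fun i => ?_, by omega⟩
  have heq := hwt
  rw [hn, wtV, wtM, ← Finset.sum_add_distrib,
    Finset.sum_eq_sum_iff_of_le fun i _ => hup i] at heq
  have := heq i (Finset.mem_univ i)
  omega

end Stmt6
end

section
/- In the Loidreau–Overbeck setting, assume rk_F(λ_(n−t−k)(E)_a⃗) = t, let h = (h^(1) | ⋯ | h^(ℓ)) ∈ F^n be a nonzero vector with L·hᵀ = 0, and let T^(i) ∈ GF(q)^(n_i×n_i) be invertible matrices such that the first (leftmost) t_i entries of h^(i)·T^(i) are zero. Put D^(i) := ((T^(i))^(−1))ᵀ. Then for every i = 1, …, ℓ, the rightmost n_i − t_i columns of E^(i)·D^(i) are zero. -/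
namespace Stmt7

/-- `genNorm σ a i = σ^(i-1)(a) ⋯ σ(a) · a`, the generalized power function `N_i(a)`. -/
def genNorm {F : Type} [Field F] (σ : F ≃+* F) (a : F) : ℕ → F
  | 0 => 1
  | i + 1 => (⇑σ)^[i] a * genNorm σ a i

/-- Generalized operator `D_a^i(b) = σ^i(b) · N_i(a)` for `i ∈ ℕ`. -/
def opev {F : Type} [Field F] (σ : F ≃+* F) (a b : F) (i : ℕ) : F :=
  (⇑σ)^[i] b * genNorm σ a i

/-- `b` is σ-conjugate to `a`, i.e. `b = σ(c)·a·c⁻¹` for some nonzero `c`. -/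
def SConj {F : Type} [Field F] (σ : F ≃+* F) (a b : F) : Prop :=
  ∃ c : F, c ≠ 0 ∧ b = σ c * a * c⁻¹

/-- σ-generalized Moore matrix `λ_d(x)_a⃗` w.r.t. the length partition `nn`:
its row `r` applies `D_{a_i}^r` entrywise to the `i`-th block of `x`. -/
def moore {F : Type} [Field F] (σ : F ≃+* F) {ℓ : ℕ} (nn : Fin ℓ → ℕ) (aa : Fin ℓ → F)
    (d : ℕ) (x : (Σ i : Fin ℓ, Fin (nn i)) → F) :
    Matrix (Fin d) (Σ i : Fin ℓ, Fin (nn i)) F :=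
  Matrix.of fun r p => opev σ (aa p.1) (x p) (r : ℕ)

/-- `λ_d(X)_a⃗` for a matrix `X`: the stack of `λ_d(x_j)_a⃗` over the rows of `X`. -/
def mooreMat {F : Type} [Field F] (σ : F ≃+* F) {ℓ : ℕ} (nn : Fin ℓ → ℕ) (aa : Fin ℓ → F)
    {s : ℕ} (d : ℕ) (X : Matrix (Fin s) (Σ i : Fin ℓ, Fin (nn i)) F) :
    Matrix (Fin s × Fin d) (Σ i : Fin ℓ, Fin (nn i)) F :=
  Matrix.of fun r p => opev σ (aa p.1) (X r.1 p) (r.2 : ℕ)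

/-- `rk_q` of a vector: the `K`-dimension of the `K`-span of its entries. -/
noncomputable def rkq (K : Type) [Field K] {F : Type} [Field F] [Algebra K F] {ι : Type}
    (v : ι → F) : ℕ :=
  Module.finrank K (Submodule.span K (Set.range v))

/-- `rk_q` of a matrix: the `K`-dimension of the `K`-span of its columns. -/
noncomputable def rkqMat (K : Type) [Field K] {F : Type} [Field F] [Algebra K F]
    {s : ℕ} {ι : Type} (X : Matrix (Fin s) ι F) : ℕ :=
  Module.finrank K (Submodule.span K (Set.range fun j : ι => fun r : Fin s => X r j))

/-- Sum-rank weight of a blockwise vector. -/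
noncomputable def wtV (K : Type) [Field K] {F : Type} [Field F] [Algebra K F] {ℓ : ℕ}
    (nn : Fin ℓ → ℕ) (x : (Σ i : Fin ℓ, Fin (nn i)) → F) : ℕ :=
  ∑ i, rkq K fun μ : Fin (nn i) => x ⟨i, μ⟩

/-- Sum-rank weight of a blockwise matrix. -/
noncomputable def wtM (K : Type) [Field K] {F : Type} [Field F] [Algebra K F] {s ℓ : ℕ}
    (nn : Fin ℓ → ℕ) (X : Matrix (Fin s) (Σ i : Fin ℓ, Fin (nn i)) F) : ℕ :=
  ∑ i, rkqMat K (Matrix.of fun (r : Fin s) (μ : Fin (nn i)) => X r ⟨i, μ⟩)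

/-- Codeword `C(M) = M · λ_k(β)_a⃗` of the `s`-interleaved linearized Reed–Solomon code. -/
def codeword {F : Type} [Field F] (σ : F ≃+* F) {ℓ : ℕ} (nn : Fin ℓ → ℕ) (aa : Fin ℓ → F)
    (β : (Σ i : Fin ℓ, Fin (nn i)) → F) {s : ℕ} (k : ℕ) (M : Matrix (Fin s) (Fin k) F) :
    Matrix (Fin s) (Σ i : Fin ℓ, Fin (nn i)) F :=
  M * moore σ nn aa k β

/-- Loidreau–Overbeck decoding matrix: the stack of `λ_{n-t-1}(β)_a⃗` and
`λ_{n-t-k}(r_j)_a⃗` for the rows `r_j` of `R`. -/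
def LOmat {F : Type} [Field F] (σ : F ≃+* F) {ℓ : ℕ} (nn : Fin ℓ → ℕ) (aa : Fin ℓ → F)
    (β : (Σ i : Fin ℓ, Fin (nn i)) → F) {s : ℕ}
    (R : Matrix (Fin s) (Σ i : Fin ℓ, Fin (nn i)) F) (n t k : ℕ) :
    Matrix (Fin (n - t - 1) ⊕ Fin s × Fin (n - t - k)) (Σ i : Fin ℓ, Fin (nn i)) F :=
  Matrix.of fun r p =>
    match r with
    | Sum.inl u => opev σ (aa p.1) (β p) (u : ℕ)
    | Sum.inr ju => opev σ (aa p.1) (R ju.1 p) (ju.2 : ℕ)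

section Operator

variable {F : Type} [Field F] (σ : F ≃+* F)

lemma genNorm_succ' (a : F) (i : ℕ) : genNorm σ a (i + 1) = σ (genNorm σ a i) * a := by
  induction i with
  | zero => simp [genNorm]
  | succ i ih =>
    have h : genNorm σ a (i + 1 + 1) = (⇑σ)^[i + 1] a * genNorm σ a (i + 1) := rfl
    have h' : genNorm σ a (i + 1) = (⇑σ)^[i] a * genNorm σ a i := rfl
    rw [h, ih, ← mul_assoc, Function.iterate_succ_apply', ← map_mul, ← h', ← ih]

lemma opev_zero (a b : F) : opev σ a b 0 = b := by
  simp [opev, genNorm]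

lemma opev_succ (a b : F) (i : ℕ) : opev σ a b (i + 1) = σ (opev σ a b i) * a := by
  simp only [opev, genNorm_succ', Function.iterate_succ_apply', map_mul]
  ring

lemma opev_add (a x y : F) (i : ℕ) : opev σ a (x + y) i = opev σ a x i + opev σ a y i := by
  induction i with
  | zero => simp only [opev_zero]
  | succ i ih => simp only [opev_succ, ih, map_add, add_mul]

lemma opev_sum {ι : Type} (S : Finset ι) (a : F) (x : ι → F) (i : ℕ) :
    opev σ a (∑ j ∈ S, x j) i = ∑ j ∈ S, opev σ a (x j) i := by
  induction i with
  | zero => simp only [opev_zero]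
  | succ i ih => simp only [opev_succ, ih, map_sum, Finset.sum_mul]

lemma opev_mul_opev (a b c : F) (u i : ℕ) :
    opev σ a (c * opev σ a b u) i = (⇑σ)^[i] c * opev σ a b (i + u) := by
  induction i with
  | zero => simp [opev_zero]
  | succ i ih =>
    rw [opev_succ, ih, Nat.add_right_comm, opev_succ, Function.iterate_succ_apply', map_mul,
      mul_assoc]

variable {K : Type} [Field K] [Algebra K F]

lemma opev_smul (hσ : ∀ κ : K, σ (algebraMap K F κ) = algebraMap K F κ) (a : F) (κ : K) (x : F)
    (i : ℕ) : opev σ a (κ • x) i = κ • opev σ a x i := by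
  induction i with
  | zero => simp only [opev_zero]
  | succ i ih => rw [opev_succ, ih, opev_succ, Algebra.smul_def, map_mul, hσ, mul_assoc,
      Algebra.smul_def]

end Operator

section Moore

variable {K F : Type} [Field K] [Field F] [Algebra K F] (σ : F ≃+* F) {ℓ : ℕ} {nn : Fin ℓ → ℕ}
  {aa : Fin ℓ → F}

/-- A vector with at most `d` nonzero entries in the right kernel of a Moore matrix with `d` rows
vanishes. -/
lemma eq_zero_of_card_support_le
    (hfix : ∀ x : F, σ x = x ↔ x ∈ Set.range (algebraMap K F))
    (ha0 : ∀ i, aa i ≠ 0)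
    (haconj : ∀ i j : Fin ℓ, i ≠ j → ¬ SConj σ (aa i) (aa j))
    {β : (Σ i : Fin ℓ, Fin (nn i)) → F}
    (hβ : ∀ i, LinearIndependent K fun μ : Fin (nn i) => β ⟨i, μ⟩)
    (d : ℕ) (S : Finset (Σ i : Fin ℓ, Fin (nn i))) (hS : S.card ≤ d)
    (c : (Σ i : Fin ℓ, Fin (nn i)) → F) (hc : ∀ p ∉ S, c p = 0)
    (hrel : ∀ r < d, ∑ p, opev σ (aa p.1) (β p) r * c p = 0) : c = 0 := by
  induction d generalizing S c with
  | zero =>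
    have : S = ∅ := by simpa using hS
    subst this
    exact funext fun p => hc p (Finset.notMem_empty p)
  | succ d ih =>
    by_contra hne
    obtain ⟨p₀, hp₀⟩ := Function.ne_iff.mp hne
    simp only [Pi.zero_apply] at hp₀
    have hp₀S : p₀ ∈ S := by
      by_contra h
      exact hp₀ (hc p₀ h)
    set c' : (Σ i : Fin ℓ, Fin (nn i)) → F := fun p => σ.symm (aa p.1 * c p) with hc'
    have hc'σ : ∀ p, σ (c' p) = aa p.1 * c p := fun p => by simp [hc']
    have hrel' : ∀ r < d, ∑ p, opev σ (aa p.1) (β p) r * c' p = 0 := by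
      intro r hr
      apply σ.injective
      rw [map_sum, map_zero, ← hrel (r + 1) (by omega)]
      refine Finset.sum_congr rfl fun p _ => ?_
      rw [map_mul, hc'σ, opev_succ, mul_assoc]
    have hprop : (fun p => c' p * c p₀ - c p * c' p₀) = 0 := by
      refine ih (S.erase p₀) ?_ _ ?_ ?_
      · rw [Finset.card_erase_of_mem hp₀S]
        omega
      · intro p hp
        by_cases hpp : p = p₀
        · subst hpp
          ring
        · have : c p = 0 := hc p fun h => hp (Finset.mem_erase.mpr ⟨hpp, h⟩)
          simp [hc', this]
      · intro r hr
        have h1 := hrel' r hr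
        have h2 := hrel r (by omega)
        calc ∑ p, opev σ (aa p.1) (β p) r * (c' p * c p₀ - c p * c' p₀)
            = (∑ p, opev σ (aa p.1) (β p) r * c' p) * c p₀
              - (∑ p, opev σ (aa p.1) (β p) r * c p) * c' p₀ := by
              rw [Finset.sum_mul, Finset.sum_mul, ← Finset.sum_sub_distrib]
              exact Finset.sum_congr rfl fun p _ => by ring
          _ = 0 := by rw [h1, h2]; ring
    have hσp₀ : σ (c p₀) ≠ 0 := by simpa using hp₀
    have hcross : ∀ p, aa p.1 * c p * σ (c p₀) = σ (c p) * (aa p₀.1 * c p₀) := by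
      intro p
      have h := sub_eq_zero.mp (congrFun hprop p)
      have h' := congrArg σ h
      rwa [map_mul, map_mul, hc'σ, hc'σ] at h'
    have hblock : ∀ p, p.1 ≠ p₀.1 → c p = 0 := by
      intro p hp
      by_contra hcp
      refine haconj _ _ hp.symm ⟨c p / c p₀, div_ne_zero hcp hp₀, ?_⟩
      have := hcross p
      rw [map_div₀]
      field_simp
      linear_combination this
    have hK : ∀ p, p.1 = p₀.1 → ∃ κ : K, algebraMap K F κ = c p / c p₀ := by
      intro p hp
      refine (hfix _).mp ?_
      have h := hcross p
      rw [hp] at h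
      rw [map_div₀, div_eq_div_iff hσp₀ hp₀]
      exact mul_left_cancel₀ (ha0 p₀.1) (by linear_combination -h)
    obtain ⟨i, μ₀⟩ := p₀
    choose κ hκ using fun μ : Fin (nn i) => hK ⟨i, μ⟩ rfl
    have hsum : ∑ μ, κ μ • β ⟨i, μ⟩ = 0 := by
      have h0 := hrel 0 (by omega)
      rw [Fintype.sum_sigma, Finset.sum_eq_single i] at h0
      · simp only [opev_zero] at h0
        calc ∑ μ, κ μ • β ⟨i, μ⟩ = (∑ μ, β ⟨i, μ⟩ * c ⟨i, μ⟩) / c ⟨i, μ₀⟩ := by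
              rw [Finset.sum_div]
              refine Finset.sum_congr rfl fun μ _ => ?_
              rw [Algebra.smul_def, hκ]
              ring
          _ = 0 := by rw [h0, zero_div]
      · intro j _ hj
        exact Finset.sum_eq_zero fun μ _ => by rw [hblock ⟨j, μ⟩ hj, mul_zero]
      · simp
    have hz := Fintype.linearIndependent_iff.mp (hβ i) κ hsum μ₀
    have h1 := hκ μ₀
    rw [hz, map_zero, div_self hp₀] at h1
    exact zero_ne_one h1

/-- In a nonzero kernel vector of a Moore matrix with `d` rows whose support lies in a set `S` of
size at most `d + 1`, the entries of each block lying in `S` are linearly independent over `K`. -/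
lemma coeff_eq_zero_of_card_support_le
    (hfix : ∀ x : F, σ x = x ↔ x ∈ Set.range (algebraMap K F))
    (ha0 : ∀ i, aa i ≠ 0)
    (haconj : ∀ i j : Fin ℓ, i ≠ j → ¬ SConj σ (aa i) (aa j))
    {β : (Σ i : Fin ℓ, Fin (nn i)) → F}
    (hβ : ∀ i, LinearIndependent K fun μ : Fin (nn i) => β ⟨i, μ⟩)
    (d : ℕ) (S : Finset (Σ i : Fin ℓ, Fin (nn i))) (hS : S.card ≤ d + 1)
    (g : (Σ i : Fin ℓ, Fin (nn i)) → F) (hg0 : g ≠ 0) (hg : ∀ p ∉ S, g p = 0)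
    (hrel : ∀ r < d, ∑ p, opev σ (aa p.1) (β p) r * g p = 0)
    (i : Fin ℓ) (κ : Fin (nn i) → K) (hκ : ∑ μ, κ μ • g ⟨i, μ⟩ = 0)
    (μ₀ : Fin (nn i)) (hμ₀ : ⟨i, μ₀⟩ ∈ S) : κ μ₀ = 0 := by
  by_contra hne
  have hσ : ∀ κ : K, σ (algebraMap K F κ) = algebraMap K F κ := fun κ => (hfix _).mpr ⟨κ, rfl⟩
  apply hg0
  set w : (Σ i : Fin ℓ, Fin (nn i)) → K := fun p =>
    if h : p.1 = i then (κ μ₀)⁻¹ * κ (h ▸ p.2) else 0 with hw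
  have hwi : ∀ μ, w ⟨i, μ⟩ = (κ μ₀)⁻¹ * κ μ := fun μ => by simp [hw]
  have hwj : ∀ j μ, j ≠ i → w ⟨j, μ⟩ = 0 := fun j μ hj => by simp [hw, hj]
  have hw₀ : w ⟨i, μ₀⟩ = 1 := by rw [hwi, inv_mul_cancel₀ hne]
  have hwg : ∑ p, w p • g p = 0 := by
    rw [Fintype.sum_sigma, Finset.sum_eq_single i]
    · simp only [hwi, mul_smul, ← Finset.smul_sum, hκ, smul_zero]
    · intro j _ hj
      exact Finset.sum_eq_zero fun μ _ => by rw [hwj j μ hj, zero_smul]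
    · simp
  set g' : (Σ i : Fin ℓ, Fin (nn i)) → F := fun p => if p = ⟨i, μ₀⟩ then 0 else g p with hg'
  set β' : (Σ i : Fin ℓ, Fin (nn i)) → F := fun p =>
    if p = ⟨i, μ₀⟩ then β p else β p + (-w p) • β ⟨i, μ₀⟩ with hβ'
  have hg'0 : g' = 0 := by
    refine eq_zero_of_card_support_le σ hfix ha0 haconj (β := β') ?_ d (S.erase ⟨i, μ₀⟩) ?_ g' ?_ ?_
    · intro j
      rw [Fintype.linearIndependent_iff]
      intro x hx
      by_cases hj : j = i
      · subst hj
        have hx' : ∑ μ, (if μ = μ₀ then x μ₀ - ∑ ν, (if ν = μ₀ then 0 else x ν * w ⟨j, ν⟩)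
            else x μ) • β ⟨j, μ⟩ = 0 := by
          rw [← hx]
          have e1 : ∀ μ, x μ • β' ⟨j, μ⟩ = x μ • β ⟨j, μ⟩ -
              (if μ = μ₀ then 0 else x μ * w ⟨j, μ⟩) • β ⟨j, μ₀⟩ := by
            intro μ
            by_cases h : μ = μ₀
            · subst h
              simp [hβ']
            · simp only [hβ', Sigma.mk.injEq, heq_eq_eq, true_and, h, if_false, smul_add, mul_smul,
                neg_smul, smul_neg]
              ring
          have e2 : ∀ μ, (if μ = μ₀ then x μ₀ - ∑ ν, (if ν = μ₀ then 0 else x ν * w ⟨j, ν⟩)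
              else x μ) • β ⟨j, μ⟩ = x μ • β ⟨j, μ⟩ - (if μ = μ₀ then
                (∑ ν, (if ν = μ₀ then 0 else x ν * w ⟨j, ν⟩)) • β ⟨j, μ₀⟩ else 0) := by
            intro μ
            by_cases h : μ = μ₀
            · subst h
              simp [sub_smul]
            · simp [h]
          simp only [e1, e2, Finset.sum_sub_distrib, Finset.sum_ite_eq', Finset.mem_univ, if_true,
            Finset.sum_smul]
        have hz := Fintype.linearIndependent_iff.mp (hβ j) _ hx'
        have hx0 : ∀ μ, μ ≠ μ₀ → x μ = 0 := fun μ hμ => by simpa [hμ] using hz μ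
        intro μ
        by_cases h : μ = μ₀
        · subst h
          have := hz μ
          rw [if_pos rfl, Finset.sum_eq_zero, sub_zero] at this
          · exact this
          · intro ν _
            by_cases h' : ν = μ
            · simp [h']
            · simp [h', hx0 ν h']
        · exact hx0 μ h
      · refine Fintype.linearIndependent_iff.mp (hβ j) x ?_
        rw [← hx]
        refine Finset.sum_congr rfl fun μ _ => ?_
        simp [hβ', hj, hwj j μ hj]
    · rw [Finset.card_erase_of_mem hμ₀]
      omega
    · intro p hp
      by_cases h : p = ⟨i, μ₀⟩
      · simp [hg', h]
      · simp only [hg', h, if_false]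
        exact hg p fun h' => hp (Finset.mem_erase.mpr ⟨h, h'⟩)
    · intro r hr
      have e : ∀ p, opev σ (aa p.1) (β' p) r * g' p = opev σ (aa p.1) (β p) r * g p -
          opev σ (aa i) (β ⟨i, μ₀⟩) r * w p • g p := by
        intro p
        by_cases h : p = ⟨i, μ₀⟩
        · subst h
          simp [hg', hw₀]
        · simp only [hg', hβ', h, if_false, opev_add, opev_smul σ hσ]
          by_cases hp : p.1 = i
          · rw [hp]
            simp only [Algebra.smul_def, map_neg]
            ring
          · obtain ⟨j, μ⟩ := p
            simp [hwj j μ hp]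
      rw [Finset.sum_congr rfl fun p _ => e p, Finset.sum_sub_distrib, hrel r hr,
        ← Finset.mul_sum, hwg]
      simp
  have hgne : ∀ p, p ≠ ⟨i, μ₀⟩ → g p = 0 := fun p hp => by
    simpa [hg', hp] using congrFun hg'0 p
  funext p
  by_cases h : p = ⟨i, μ₀⟩
  · rw [Finset.sum_eq_single ⟨i, μ₀⟩ (fun q _ hq => by rw [hgne q hq, smul_zero]) (by simp), hw₀,
      one_smul] at hwg
    rw [h, hwg, Pi.zero_apply]
  · exact hgne p h

/-- A matrix over `F` factors through a basis of the `K`-span of its columns. -/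
lemma exists_column_factorization {s m : ℕ} (X : Matrix (Fin s) (Fin m) F) :
    ∃ (A : Matrix (Fin s) (Fin (rkqMat K X)) F) (B : Matrix (Fin (rkqMat K X)) (Fin m) K),
      ∀ r ν, X r ν = ∑ j, B j ν • A r j := by
  set V := Submodule.span K (Set.range fun j : Fin m => fun r : Fin s => X r j) with hV
  have : FiniteDimensional K V := FiniteDimensional.span_of_finite K (Set.finite_range _)
  let b : Module.Basis (Fin (rkqMat K X)) K V := Module.finBasis K V
  let v : Fin m → V := fun ν => ⟨fun r => X r ν, Submodule.subset_span ⟨ν, rfl⟩⟩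
  refine ⟨Matrix.of fun r j => (b j : Fin s → F) r, Matrix.of fun j ν => b.repr (v ν) j, ?_⟩
  intro r ν
  have h := congrArg (fun x : V => (x : Fin s → F) r) (b.sum_repr (v ν))
  simp only [Submodule.coe_sum, Submodule.coe_smul, Finset.sum_apply, Pi.smul_apply] at h
  exact h.symm

end Moore

lemma mulVec_eq_zero_of_rank_eq_card {F m ι κ : Type} [Field F] [Fintype m] [Fintype ι] [Fintype κ]
    (A : Matrix m κ F) (B : Matrix κ ι F) (hr : (A * B).rank = Fintype.card κ)
    {v : ι → F} (hv : (A * B).mulVec v = 0) : B.mulVec v = 0 := by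
  have hA : A.rank = Fintype.card κ :=
    le_antisymm A.rank_le_card_width (hr ▸ Matrix.rank_mul_le_left A B)
  have hker : LinearMap.ker A.mulVecLin = ⊥ := by
    have h := A.mulVecLin.finrank_range_add_finrank_ker
    rw [Module.finrank_fintype_fun_eq_card] at h
    unfold Matrix.rank at hA
    exact Submodule.finrank_eq_zero.mp (by omega)
  rw [← Matrix.mulVec_mulVec] at hv
  exact LinearMap.ker_eq_bot'.mp hker _ hv

/-- The Moore matrix of the error is annihilated by every vector in the kernel of the decoding
matrix. -/
lemma mooreMat_error_mulVec_eq_zero {F : Type} [Field F] (σ : F ≃+* F) {ℓ : ℕ} (nn : Fin ℓ → ℕ)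
    (aa : Fin ℓ → F) (β : (Σ i : Fin ℓ, Fin (nn i)) → F) {s k n t : ℕ}
    (M : Matrix (Fin s) (Fin k) F) (E : Matrix (Fin s) (Σ i : Fin ℓ, Fin (nn i)) F)
    (h : (Σ i : Fin ℓ, Fin (nn i)) → F)
    (hker : (LOmat σ nn aa β (codeword σ nn aa β k M + E) n t k).mulVec h = 0) :
    (mooreMat σ nn aa (n - t - k) E).mulVec h = 0 := by
  funext ⟨j, u⟩
  have hβ : ∀ r < n - t - 1, ∑ p, opev σ (aa p.1) (β p) r * h p = 0 := fun r hr =>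
    congrFun hker (Sum.inl ⟨r, hr⟩)
  have hE : ∑ p, opev σ (aa p.1) ((codeword σ nn aa β k M + E) j p) u * h p = 0 :=
    congrFun hker (Sum.inr (j, u))
  have e : ∀ p, opev σ (aa p.1) ((codeword σ nn aa β k M + E) j p) u * h p =
      (∑ v : Fin k, (⇑σ)^[u] (M j v) * (opev σ (aa p.1) (β p) (u + v) * h p)) +
        opev σ (aa p.1) (E j p) u * h p := by
    intro p
    simp only [codeword, moore, Matrix.add_apply, Matrix.mul_apply, Matrix.of_apply, opev_add,
      opev_sum, opev_mul_opev, add_mul, Finset.sum_mul, mul_assoc]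
  simp only [e, Finset.sum_add_distrib] at hE
  rw [Finset.sum_comm, Finset.sum_eq_zero, zero_add] at hE
  · exact hE
  · intro v _
    rw [← Finset.mul_sum, hβ _ (by omega), mul_zero]

/-- If `rk_F(λ_{n−t−k}(E)_a⃗) = t`, `h ≠ 0` is in the right kernel of `L`, and
`T^(i) ∈ GF(q)^{n_i×n_i}` are invertible with the first `t_i` entries of `h^(i)·T^(i)`
zero, then with `D^(i) := ((T^(i))⁻¹)ᵀ`, the rightmost `n_i − t_i` columns of
`E^(i)·D^(i)` are zero. -/
theorem LO_transformed_error_zero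
    {K F : Type} [Field K] [Field F] [Algebra K F] [Fintype K] [Fintype F]
    (σ : F ≃+* F)
    (hfix : ∀ x : F, σ x = x ↔ x ∈ Set.range (algebraMap K F))
    {ℓ : ℕ} (hℓ : 1 ≤ ℓ) (nn : Fin ℓ → ℕ) (aa : Fin ℓ → F)
    (ha0 : ∀ i, aa i ≠ 0)
    (haconj : ∀ i j : Fin ℓ, i ≠ j → ¬ SConj σ (aa i) (aa j))
    (β : (Σ i : Fin ℓ, Fin (nn i)) → F)
    (hβ : ∀ i, LinearIndependent K fun μ : Fin (nn i) => β ⟨i, μ⟩)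
    {s : ℕ} (hs : 1 ≤ s) {k n t : ℕ} (hn : n = ∑ i, nn i)
    (hk : 1 ≤ k) (hkn : k ≤ n)
    (M : Matrix (Fin s) (Fin k) F)
    (E R : Matrix (Fin s) (Σ i : Fin ℓ, Fin (nn i)) F)
    (hR : R = codeword σ nn aa β k M + E)
    (ht : wtM K nn E = t) (htnk : t ≤ n - k)
    (hrk : (mooreMat σ nn aa (n - t - k) E).rank = t)
    (h : (Σ i : Fin ℓ, Fin (nn i)) → F) (hh0 : h ≠ 0)
    (hker : (LOmat σ nn aa β R n t k).mulVec h = 0)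
    (T : (i : Fin ℓ) → Matrix (Fin (nn i)) (Fin (nn i)) K)
    (hT : ∀ i, IsUnit (T i))
    (hTz : ∀ (i : Fin ℓ) (μ : Fin (nn i)),
      (μ : ℕ) < rkqMat K (Matrix.of fun (r : Fin s) (ν : Fin (nn i)) => E r ⟨i, ν⟩) →
      ∑ ν : Fin (nn i), h ⟨i, ν⟩ * algebraMap K F (T i ν μ) = 0) :
    ∀ (i : Fin ℓ) (μ : Fin (nn i)),
      rkqMat K (Matrix.of fun (r : Fin s) (ν : Fin (nn i)) => E r ⟨i, ν⟩) ≤ (μ : ℕ) →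
      ∀ r : Fin s,
        ∑ ν : Fin (nn i), E r ⟨i, ν⟩ * algebraMap K F (((T i)⁻¹).transpose ν μ) = 0 := by
  have hσ : ∀ κ : K, σ (algebraMap K F κ) = algebraMap K F κ := fun κ => (hfix _).mpr ⟨κ, rfl⟩
  subst hR
  set τ : Fin ℓ → ℕ := fun i =>
    rkqMat K (Matrix.of fun (r : Fin s) (ν : Fin (nn i)) => E r ⟨i, ν⟩) with hτ
  have hτsum : ∑ i, τ i = t := ht
  have hτle : ∀ i, τ i ≤ nn i := fun i =>
    (finrank_range_le_card (R := K)
      (fun (ν : Fin (nn i)) (r : Fin s) => E r ⟨i, ν⟩)).trans_eq (Fintype.card_fin _)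
  choose A B hAB using fun i => exists_column_factorization (K := K)
    (Matrix.of fun (r : Fin s) (ν : Fin (nn i)) => E r ⟨i, ν⟩)
  simp only [Matrix.of_apply] at hAB
  -- the coefficient matrices annihilate the blocks of `h`
  have hBh : ∀ i j, ∑ ν, B i j ν • h ⟨i, ν⟩ = 0 := by
    let Λ : Matrix (Fin s × Fin (n - t - k)) (Σ i : Fin ℓ, Fin (τ i)) F :=
      mooreMat σ τ aa (n - t - k) (Matrix.of fun r p => A p.1 r p.2)
    let P : Matrix (Σ i : Fin ℓ, Fin (τ i)) (Σ i : Fin ℓ, Fin (nn i)) F :=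
      Matrix.blockDiagonal' fun i => (B i).map (algebraMap K F)
    have hfac : mooreMat σ nn aa (n - t - k) E = Λ * P := by
      ext ⟨r, u⟩ ⟨i, ν⟩
      rw [Matrix.mul_apply, Fintype.sum_sigma, Finset.sum_eq_single i]
      · simp only [mooreMat, Λ, P, Matrix.of_apply, Matrix.blockDiagonal'_apply_eq, Matrix.map_apply,
          hAB, opev_sum, opev_smul σ hσ]
        exact Finset.sum_congr rfl fun j _ => by rw [Algebra.smul_def, mul_comm]
      · intro i' _ hi'
        refine Finset.sum_eq_zero fun j _ => ?_
        simp only [P, Matrix.blockDiagonal'_apply_ne _ _ _ hi', mul_zero]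
      · simp
    have hEh := mooreMat_error_mulVec_eq_zero σ nn aa β M E h hker
    rw [hfac] at hEh hrk
    have hPh := mulVec_eq_zero_of_rank_eq_card Λ P (by simp [hrk, hτsum]) hEh
    intro i j
    have hij := congrFun hPh ⟨i, j⟩
    rw [Matrix.mulVec, dotProduct, Fintype.sum_sigma, Finset.sum_eq_single i] at hij
    · simpa [P, Matrix.blockDiagonal'_apply_eq, Algebra.smul_def] using hij
    · intro i' _ hi'
      refine Finset.sum_eq_zero fun ν _ => ?_
      simp only [P, Matrix.blockDiagonal'_apply_ne _ _ _ hi'.symm, zero_mul]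
    · simp
  have hTT : ∀ i, T i * (T i)⁻¹ = 1 := fun i =>
    Matrix.mul_nonsing_inv _ ((Matrix.isUnit_iff_isUnit_det _).mp (hT i))
  have hTT' : ∀ i, (T i)⁻¹ * T i = 1 := fun i =>
    Matrix.nonsing_inv_mul _ ((Matrix.isUnit_iff_isUnit_det _).mp (hT i))
  -- `g` is the transformed kernel vector, `β'` the correspondingly transformed code locators
  set g : (Σ i : Fin ℓ, Fin (nn i)) → F := fun p => ∑ ν, T p.1 ν p.2 • h ⟨p.1, ν⟩ with hg
  set β' : (Σ i : Fin ℓ, Fin (nn i)) → F := fun p => ∑ ν, (T p.1)⁻¹ p.2 ν • β ⟨p.1, ν⟩ with hβ'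
  have hhg : ∀ i ν, h ⟨i, ν⟩ = ∑ μ, (T i)⁻¹ μ ν • g ⟨i, μ⟩ := by
    intro i ν
    have hgi : ∀ μ, g ⟨i, μ⟩ = ∑ ν, T i ν μ • h ⟨i, ν⟩ := fun _ => rfl
    simp only [hgi, Finset.smul_sum, smul_smul]
    rw [Finset.sum_comm]
    have e : ∀ ν', ∑ μ, ((T i)⁻¹ μ ν * T i ν' μ) • h ⟨i, ν'⟩ =
        (1 : Matrix (Fin (nn i)) (Fin (nn i)) K) ν' ν • h ⟨i, ν'⟩ := by
      intro ν'
      rw [← hTT i, Matrix.mul_apply, Finset.sum_smul]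
      exact Finset.sum_congr rfl fun μ _ => by rw [mul_comm]
    simp [e, Matrix.one_apply]
  have hg0 : g ≠ 0 := by
    intro hz
    apply hh0
    funext ⟨i, ν⟩
    simp [hhg, hz]
  have hβ'li : ∀ i, LinearIndependent K fun μ : Fin (nn i) => β' ⟨i, μ⟩ := by
    intro i
    rw [Fintype.linearIndependent_iff]
    intro x hx
    have hx' : ∑ ν, (Matrix.vecMul x (T i)⁻¹) ν • β ⟨i, ν⟩ = 0 := by
      rw [← hx]
      simp only [hβ', Matrix.vecMul, dotProduct, Finset.sum_smul, Finset.smul_sum, mul_smul]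
      exact Finset.sum_comm
    have hz : Matrix.vecMul x (T i)⁻¹ = 0 :=
      funext (Fintype.linearIndependent_iff.mp (hβ i) _ hx')
    have hz' := congrArg (fun y => Matrix.vecMul y (T i)) hz
    simp only [Matrix.vecMul_vecMul, hTT', Matrix.vecMul_one, Matrix.zero_vecMul] at hz'
    exact congrFun hz'
  have hrel : ∀ r < n - t - 1, ∑ p, opev σ (aa p.1) (β' p) r * g p = 0 := by
    intro r hr
    have hr' : ∑ p, opev σ (aa p.1) (β p) r * h p = 0 := congrFun hker (Sum.inl ⟨r, hr⟩)
    rw [← hr', Fintype.sum_sigma, Fintype.sum_sigma]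
    refine Finset.sum_congr rfl fun i _ => ?_
    simp only [hβ', hhg, opev_sum, opev_smul σ hσ, Finset.sum_mul, Finset.mul_sum]
    rw [Finset.sum_comm]
    refine Finset.sum_congr rfl fun ν _ => Finset.sum_congr rfl fun μ _ => ?_
    rw [smul_mul_assoc, mul_smul_comm]
  let S : Finset (Σ i : Fin ℓ, Fin (nn i)) :=
    Finset.univ.sigma fun i => Finset.univ.filter fun μ : Fin (nn i) => τ i ≤ (μ : ℕ)
  have hScard : S.card = n - t := by
    have hcard : ∀ i, (Finset.univ.filter fun μ : Fin (nn i) => τ i ≤ (μ : ℕ)).card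
        = nn i - τ i := by
      intro i
      have h1 := Finset.card_filter_add_card_filter_not (s := (Finset.univ : Finset (Fin (nn i))))
        (fun μ => (μ : ℕ) < τ i)
      have h2 := Fin.card_filter_val_lt (n := nn i) (m := τ i)
      simp only [not_lt, Finset.card_univ, Fintype.card_fin] at h1
      have := hτle i
      omega
    rw [Finset.card_sigma, Finset.sum_congr rfl fun i _ => hcard i, hn, ← hτsum]
    exact Finset.sum_tsub_distrib _ fun i _ => hτle i
  have hgS : ∀ p ∉ S, g p = 0 := by
    rintro ⟨i, μ⟩ hp
    have hlt : (μ : ℕ) < τ i := by simpa [S] using hp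
    rw [← hTz i μ hlt]
    exact Finset.sum_congr rfl fun ν _ => by rw [Algebra.smul_def, mul_comm]
  intro i μ hμ r
  have hBT : ∀ j, ∑ ν, B i j ν * (T i)⁻¹ μ ν = 0 := by
    intro j
    refine coeff_eq_zero_of_card_support_le σ hfix ha0 haconj hβ'li (n - t - 1) S (by omega) g hg0
      hgS hrel i (fun μ => ∑ ν, B i j ν * (T i)⁻¹ μ ν) ?_ μ (by simpa [S] using hμ)
    rw [← hBh i j]
    simp only [hhg, Finset.smul_sum, Finset.sum_smul, smul_smul]
    exact Finset.sum_comm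
  calc ∑ ν, E r ⟨i, ν⟩ * algebraMap K F (((T i)⁻¹).transpose ν μ)
      = ∑ j, (∑ ν, B i j ν * (T i)⁻¹ μ ν) • A i r j := by
        simp only [hAB, Finset.sum_mul, Finset.sum_smul, Matrix.transpose_apply]
        rw [Finset.sum_comm]
        refine Finset.sum_congr rfl fun j _ => Finset.sum_congr rfl fun ν _ => ?_
        simp only [Algebra.smul_def, map_mul]
        ring
    _ = 0 := by simp only [hBT, zero_smul, Finset.sum_const_zero]

end Stmt7
end

section
/- Let s ≥ 1, 1 ≤ k ≤ n, assume a_1, …, a_ℓ are nonzero and pairwise non-σ-conjugate, let t ∈ ℕ satisfy (s+1)·t ≤ s·(n−k), and let κ_q := ∏_(i=1)^∞ (1 − q^(−i))^(−1) ∈ ℝ. Then, as an inequality of real numbers, #{E ∈ F^(s×n) : wt_ΣR(E) = t and rk_F(λ_(n−t−k)(E)_a⃗) < t} ≤ κ_q^(ℓ+1) · q^(−m·(s(n−k) − (s+1)t + 1)) · #{E ∈ F^(s×n) : wt_ΣR(E) = t}. Equivalently, a matrix E drawn uniformly at random from the set of matrices in F^(s×n) of sum-rank weight t satisfies rk_F(λ_(n−t−k)(E)_a⃗)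 = t with probability at least 1 − κ_q^(ℓ+1)·q^(−m·(s(n−k)−(s+1)t+1)). -/
namespace Stmt9

/-- `genNorm σ a i = σ^(i-1)(a) ⋯ σ(a) · a`, the generalized power function `N_i(a)`. -/
def genNorm {F : Type} [Field F] (σ : F ≃+* F) (a : F) : ℕ → F
  | 0 => 1
  | i + 1 => (⇑σ)^[i] a * genNorm σ a i

/-- Generalized operator `D_a^i(b) = σ^i(b) · N_i(a)` for `i ∈ ℕ`. -/
def opev {F : Type} [Field F] (σ : F ≃+* F) (a b : F) (i : ℕ) : F :=
  (⇑σ)^[i] b * genNorm σ a i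

/-- `b` is σ-conjugate to `a`, i.e. `b = σ(c)·a·c⁻¹` for some nonzero `c`. -/
def SConj {F : Type} [Field F] (σ : F ≃+* F) (a b : F) : Prop :=
  ∃ c : F, c ≠ 0 ∧ b = σ c * a * c⁻¹

/-- σ-generalized Moore matrix `λ_d(x)_a⃗` w.r.t. the length partition `nn`:
its row `r` applies `D_{a_i}^r` entrywise to the `i`-th block of `x`. -/
def moore {F : Type} [Field F] (σ : F ≃+* F) {ℓ : ℕ} (nn : Fin ℓ → ℕ) (aa : Fin ℓ → F)
    (d : ℕ) (x : (Σ i : Fin ℓ, Fin (nn i)) → F) :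
    Matrix (Fin d) (Σ i : Fin ℓ, Fin (nn i)) F :=
  Matrix.of fun r p => opev σ (aa p.1) (x p) (r : ℕ)

/-- `λ_d(X)_a⃗` for a matrix `X`: the stack of `λ_d(x_j)_a⃗` over the rows of `X`. -/
def mooreMat {F : Type} [Field F] (σ : F ≃+* F) {ℓ : ℕ} (nn : Fin ℓ → ℕ) (aa : Fin ℓ → F)
    {s : ℕ} (d : ℕ) (X : Matrix (Fin s) (Σ i : Fin ℓ, Fin (nn i)) F) :
    Matrix (Fin s × Fin d) (Σ i : Fin ℓ, Fin (nn i)) F :=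
  Matrix.of fun r p => opev σ (aa p.1) (X r.1 p) (r.2 : ℕ)

/-- `rk_q` of a vector: the `K`-dimension of the `K`-span of its entries. -/
noncomputable def rkq (K : Type) [Field K] {F : Type} [Field F] [Algebra K F] {ι : Type}
    (v : ι → F) : ℕ :=
  Module.finrank K (Submodule.span K (Set.range v))

/-- `rk_q` of a matrix: the `K`-dimension of the `K`-span of its columns. -/
noncomputable def rkqMat (K : Type) [Field K] {F : Type} [Field F] [Algebra K F]
    {s : ℕ} {ι : Type} (X : Matrix (Fin s) ι F) : ℕ :=
  Module.finrank K (Submodule.span K (Set.range fun j : ι => fun r : Fin s => X r j))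

/-- Sum-rank weight of a blockwise vector. -/
noncomputable def wtV (K : Type) [Field K] {F : Type} [Field F] [Algebra K F] {ℓ : ℕ}
    (nn : Fin ℓ → ℕ) (x : (Σ i : Fin ℓ, Fin (nn i)) → F) : ℕ :=
  ∑ i, rkq K fun μ : Fin (nn i) => x ⟨i, μ⟩

/-- Sum-rank weight of a blockwise matrix. -/
noncomputable def wtM (K : Type) [Field K] {F : Type} [Field F] [Algebra K F] {s ℓ : ℕ}
    (nn : Fin ℓ → ℕ) (X : Matrix (Fin s) (Σ i : Fin ℓ, Fin (nn i)) F) : ℕ :=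
  ∑ i, rkqMat K (Matrix.of fun (r : Fin s) (μ : Fin (nn i)) => X r ⟨i, μ⟩)

/-- Codeword `C(M) = M · λ_k(β)_a⃗` of the `s`-interleaved linearized Reed–Solomon code. -/
def codeword {F : Type} [Field F] (σ : F ≃+* F) {ℓ : ℕ} (nn : Fin ℓ → ℕ) (aa : Fin ℓ → F)
    (β : (Σ i : Fin ℓ, Fin (nn i)) → F) {s : ℕ} (k : ℕ) (M : Matrix (Fin s) (Fin k) F) :
    Matrix (Fin s) (Σ i : Fin ℓ, Fin (nn i)) F :=
  M * moore σ nn aa k β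

/-- `κ_q = ∏_{i=1}^∞ (1 − q^{−i})⁻¹`. -/
noncomputable def kappa (q : ℕ) : ℝ := ∏' i : ℕ, ((1 : ℝ) - ((q : ℝ))⁻¹ ^ (i + 1))⁻¹

/-- The additive map `c ↦ σ⁻¹(c·a)`, adjoint to the generalized operator `b ↦ σ(b)·a`. -/
def backShift {F : Type} [Field F] (σ : F ≃+* F) (a : F) : F →+ F :=
  (σ.symm : F →+ F).comp (AddMonoidHom.mulRight a)

section Operators

variable {F : Type} [Field F] (σ : F ≃+* F)

theorem backShift_apply (a c : F) : backShift σ a c = σ.symm (c * a) := rfl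

theorem backShift_mul (a u c : F) : backShift σ a (u * c) = σ.symm u * backShift σ a c := by
  simp only [backShift_apply, ← map_mul, mul_assoc]

theorem iterate_backShift_mul (a u c : F) (r : ℕ) :
    (backShift σ a)^[r] (u * c) = (⇑σ.symm)^[r] u * (backShift σ a)^[r] c := by
  induction r with
  | zero => rfl
  | succ r ih => simp only [Function.iterate_succ_apply', ih, backShift_mul]

theorem iterate_backShift_sum {ι : Type} (s : Finset ι) (a : F) (c : ι → F) (r : ℕ) :
    (backShift σ a)^[r] (∑ i ∈ s, c i) = ∑ i ∈ s, (backShift σ a)^[r] (c i) := by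
  induction r with
  | zero => rfl
  | succ r ih => simp only [Function.iterate_succ_apply', ih, map_sum]

theorem iterate_symm_mul_genNorm (a c : F) (r : ℕ) :
    (⇑σ.symm)^[r] (c * genNorm σ a r) = (backShift σ a)^[r] c := by
  induction r with
  | zero => simp [genNorm]
  | succ r ih =>
    rw [Function.iterate_succ_apply', Function.iterate_succ_apply', ← ih, backShift_apply, genNorm,
      mul_left_comm, iterate_map_mul σ.symm, (show Function.LeftInverse σ.symm σ from
        σ.symm_apply_apply).iterate r a, mul_comm]

theorem iterate_symm_mul_opev (a b c : F) (r : ℕ) :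
    (⇑σ.symm)^[r] (c * opev σ a b r) = b * (backShift σ a)^[r] c := by
  rw [opev, mul_left_comm, iterate_map_mul σ.symm, iterate_symm_mul_genNorm,
    (show Function.LeftInverse σ.symm σ from σ.symm_apply_apply).iterate r b]

theorem opev_add (a b b' : F) (r : ℕ) : opev σ a (b + b') r = opev σ a b r + opev σ a b' r := by
  simp only [opev, iterate_map_add σ, add_mul]

theorem opev_sum {ι : Type} (s : Finset ι) (a : F) (b : ι → F) (r : ℕ) :
    opev σ a (∑ i ∈ s, b i) r = ∑ i ∈ s, opev σ a (b i) r :=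
  map_sum (AddMonoidHom.mk' (fun b => opev σ a b r) fun b b' => opev_add σ a b b' r) b s

theorem sum_mul_opev_eq_zero_iff {ι : Type} [Fintype ι] (a c b : ι → F) (r : ℕ) :
    ∑ p, c p * opev σ (a p) (b p) r = 0 ↔ ∑ p, b p * (backShift σ (a p))^[r] (c p) = 0 := by
  have h : (⇑σ.symm)^[r] (∑ p, c p * opev σ (a p) (b p) r) =
      ∑ p, b p * (backShift σ (a p))^[r] (c p) := by
    simp only [← iterate_symm_mul_opev, ← RingAut.coe_pow, map_sum]
  rw [← h, ← RingAut.coe_pow, EmbeddingLike.map_eq_zero_iff]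

variable {K : Type} [Field K] [Algebra K F]

theorem opev_smul (hσ : ∀ y : K, σ (algebraMap K F y) = algebraMap K F y) (a b : F) (y : K)
    (r : ℕ) : opev σ a (y • b) r = y • opev σ a b r := by
  simp only [opev, Algebra.smul_def, iterate_map_mul σ, Function.iterate_fixed (hσ y), mul_assoc]

theorem backShift_smul (hσ : ∀ y : K, σ (algebraMap K F y) = algebraMap K F y) (a c : F) (y : K) :
    backShift σ a (y • c) = y • backShift σ a c := by
  rw [Algebra.smul_def, backShift_mul, σ.symm_apply_eq.2 (hσ y).symm, ← Algebra.smul_def]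

theorem iterate_backShift_smul (hσ : ∀ y : K, σ (algebraMap K F y) = algebraMap K F y) (a c : F)
    (y : K) (r : ℕ) : (backShift σ a)^[r] (y • c) = y • (backShift σ a)^[r] c := by
  induction r with
  | zero => rfl
  | succ r ih => simp only [Function.iterate_succ_apply', ih, backShift_smul σ hσ]

end Operators

section MooreRank

variable {K F : Type} [Field K] [Field F] [Algebra K F] (σ : F ≃+* F)
  (hfix : ∀ x : F, σ x = x ↔ x ∈ Set.range (algebraMap K F))
  {ℓ : ℕ} {aa : Fin ℓ → F} (ha0 : ∀ i, aa i ≠ 0)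
  (haconj : ∀ i j : Fin ℓ, i ≠ j → ¬ SConj σ (aa i) (aa j))

include ha0 haconj hfix in
theorem mem_span_single_of_backShift_eq {i₀ : Fin ℓ} {c₀ : F} (hc₀ : c₀ ≠ 0) (y : Fin ℓ → F)
    (hy : ∀ j, backShift σ (aa j) (y j) = backShift σ (aa i₀) c₀ / c₀ * y j) :
    y ∈ Submodule.span K {(Pi.single i₀ c₀ : Fin ℓ → F)} := by
  have key : ∀ j, y j * aa j * σ c₀ = c₀ * aa i₀ * σ (y j) := by
    intro j
    have h := congrArg σ (hy j)
    simp only [backShift_apply, map_mul, map_div₀, RingEquiv.apply_symm_apply] at h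
    have : σ c₀ ≠ 0 := by simpa using hc₀
    field_simp at h
    linear_combination h
  have hz : ∀ j, j ≠ i₀ → y j = 0 := by
    intro j hj
    by_contra hne
    refine haconj i₀ j hj.symm ⟨y j / c₀, div_ne_zero hne hc₀, ?_⟩
    have : σ c₀ ≠ 0 := by simpa using hc₀
    rw [map_div₀]
    field_simp
    linear_combination key j
  obtain ⟨k, hk⟩ := (hfix (y i₀ / c₀)).1 (by
    have : σ c₀ ≠ 0 := by simpa using hc₀
    have h := key i₀
    rw [map_div₀, div_eq_div_iff this hc₀]
    apply mul_right_cancel₀ (ha0 i₀)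
    linear_combination -h)
  refine Submodule.mem_span_singleton.2 ⟨k, ?_⟩
  ext j
  by_cases hj : j = i₀
  · subst hj
    simp [Algebra.smul_def, hk, hc₀]
  · simp [hj, hz j hj]

include ha0 haconj hfix in
theorem eq_zero_of_sum_mul_iterate_backShift_fin {N : ℕ} (idx : Fin N → Fin ℓ) (c : Fin N → F)
    (hc : LinearIndependent K fun p => (Pi.single (idx p) (c p) : Fin ℓ → F))
    (x : Fin N → F) (hx : ∀ r < N, ∑ p, x p * (backShift σ (aa (idx p)))^[r] (c p) = 0) :
    x = 0 := by
  have hσ : ∀ y : K, σ (algebraMap K F y) = algebraMap K F y := fun y => (hfix _).2 ⟨y, rfl⟩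
  induction N with
  | zero => exact Subsingleton.elim _ _
  | succ N ih =>
    set u := backShift σ (aa (idx 0)) (c 0) / c 0 with hu
    have hc0 : c 0 ≠ 0 := by
      intro h
      exact hc.ne_zero 0 (by simp [h])
    let L : (Fin ℓ → F) →ₗ[K] (Fin ℓ → F) :=
      { toFun := fun y j => backShift σ (aa j) (y j) - u * y j
        map_add' := fun y z => by
          ext j
          simp only [Pi.add_apply, map_add, mul_add]
          ring
        map_smul' := fun k y => by
          ext j
          simp only [Pi.smul_apply, backShift_smul σ hσ, RingHom.id_apply, smul_sub,
            mul_smul_comm] }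
    have hL : ∀ i z, L (Pi.single i z) = Pi.single i (backShift σ (aa i) z - u * z) := by
      intro i z
      ext j
      by_cases hj : j = i
      · subst hj
        simp [L]
      · simp [L, hj]
    have hLc0 : backShift σ (aa (idx 0)) (c 0) - u * c 0 = 0 := by
      rw [hu, div_mul_cancel₀ _ hc0, sub_self]
    obtain ⟨htail, hnot⟩ := linearIndependent_finSucc.1 hc
    have hker : LinearMap.ker L ≤
        Submodule.span K {(Pi.single (idx 0) (c 0) : Fin ℓ → F)} := fun y hy =>
      mem_span_single_of_backShift_eq σ hfix ha0 haconj hc0 y fun j =>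
        sub_eq_zero.1 (congrFun (LinearMap.mem_ker.1 hy) j)
    have hind := htail.map (f := L) (Disjoint.mono_right hker
      ((Submodule.disjoint_span_singleton' (hc.ne_zero 0)).2 hnot))
    have htl : (fun p : Fin N => x p.succ) = 0 := by
      refine ih (fun p => idx p.succ)
        (fun p => backShift σ (aa (idx p.succ)) (c p.succ) - u * c p.succ) ?_ _ ?_
      · have heq : (fun p : Fin N => (Pi.single (idx p.succ)
            (backShift σ (aa (idx p.succ)) (c p.succ) - u * c p.succ) : Fin ℓ → F)) =
            L ∘ Fin.tail fun p => (Pi.single (idx p) (c p) : Fin ℓ → F) :=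
          funext fun p => (hL _ _).symm
        rw [heq]
        exact hind
      · intro r hr
        have h1 := hx (r + 1) (by omega)
        have h0 := hx r (by omega)
        have : ∑ p : Fin (N + 1), x p * (backShift σ (aa (idx p)))^[r]
            (backShift σ (aa (idx p)) (c p) - u * c p) = 0 := by
          simp only [iterate_map_sub, iterate_backShift_mul, mul_sub, Finset.sum_sub_distrib,
            ← Function.iterate_succ_apply, h1, mul_left_comm (x _), ← Finset.mul_sum, h0,
            mul_zero, sub_zero]
        rw [Fin.sum_univ_succ, hLc0, iterate_map_zero, mul_zero, zero_add] at this
        exact this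
    have h0 := hx 0 (by omega)
    simp only [Function.iterate_zero_apply, Fin.sum_univ_succ] at h0
    have hs : ∀ p : Fin N, x p.succ = 0 := fun p => congrFun htl p
    simp only [hs, zero_mul, Finset.sum_const_zero, add_zero, mul_eq_zero, hc0, or_false] at h0
    ext p
    exact Fin.cases h0 hs p

include ha0 haconj hfix in
theorem eq_zero_of_sum_mul_iterate_backShift {κ : Type} [Fintype κ] (idx : κ → Fin ℓ) (c : κ → F)
    (hc : LinearIndependent K fun p => (Pi.single (idx p) (c p) : Fin ℓ → F)) {d : ℕ}
    (hd : Fintype.card κ ≤ d) (x : κ → F)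
    (hx : ∀ r < d, ∑ p, x p * (backShift σ (aa (idx p)))^[r] (c p) = 0) : x = 0 := by
  let e := (Fintype.equivFin κ).symm
  have := eq_zero_of_sum_mul_iterate_backShift_fin σ hfix ha0 haconj (idx ∘ e) (c ∘ e)
    (hc.comp e e.injective) (x ∘ e) fun r hr => by
      rw [← hx r (hr.trans_le hd), ← Equiv.sum_comp e]
      rfl
  ext p
  simpa using congrFun this (e.symm p)

end MooreRank

section Counting

/-- `c` lies in the right kernel of the Moore matrix of the matrix with column blocks `A i`. -/
def MooreRel {F : Type} [Field F] (σ : F ≃+* F) {ℓ s : ℕ} (aa : Fin ℓ → F) (d : ℕ)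
    {tt : Fin ℓ → ℕ} (A : ∀ i, Fin (tt i) → Fin s → F) (c : (Σ i, Fin (tt i)) → F) : Prop :=
  ∀ j, ∀ r < d, ∑ p : Σ i, Fin (tt i), c p * opev σ (aa p.1) (A p.1 p.2 j) r = 0

variable {K F : Type} [Field K] [Field F] [Algebra K F] (σ : F ≃+* F)
  (hfix : ∀ x : F, σ x = x ↔ x ∈ Set.range (algebraMap K F))
  {ℓ s : ℕ} {aa : Fin ℓ → F} (ha0 : ∀ i, aa i ≠ 0)
  (haconj : ∀ i j : Fin ℓ, i ≠ j → ¬ SConj σ (aa i) (aa j)) {tt : Fin ℓ → ℕ}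

theorem MooreRel.smul {σ : F ≃+* F} {d : ℕ} {A : ∀ i, Fin (tt i) → Fin s → F}
    {c : (Σ i, Fin (tt i)) → F} (h : MooreRel σ aa d A c) (u : F) :
    MooreRel σ aa d A (u • c) := by
  intro j r hr
  simp only [Pi.smul_apply, smul_eq_mul, mul_assoc, ← Finset.mul_sum, h j r hr, mul_zero]

include ha0 haconj hfix in
theorem MooreRel.lt_card {d : ℕ} {A : ∀ i, Fin (tt i) → Fin s → F}
    {c : (Σ i, Fin (tt i)) → F} (h : MooreRel σ aa d A c) (hc : c ≠ 0)
    (hA : ∀ i, LinearIndependent K (A i)) {κ : Fin ℓ → Type} [∀ i, Fintype (κ i)]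
    (e : ∀ i, κ i → Fin (tt i))
    (hspan : ∀ i k, c ⟨i, k⟩ ∈ Submodule.span K (Set.range fun k => c ⟨i, e i k⟩))
    (hind : ∀ i, LinearIndependent K fun k => c ⟨i, e i k⟩) :
    d < Fintype.card (Σ i, κ i) := by
  have hσ : ∀ y : K, σ (algebraMap K F y) = algebraMap K F y := fun y => (hfix _).2 ⟨y, rfl⟩
  by_contra! hd
  simp only [Submodule.mem_span_range_iff_exists_fun] at hspan
  choose β hβ using hspan
  have hzero : ∀ j, (fun p : Σ i, κ i => ∑ k, β p.1 k p.2 • A p.1 k j) = 0 := by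
    intro j
    refine eq_zero_of_sum_mul_iterate_backShift (K := K) σ hfix ha0 haconj
      (fun p : Σ i, κ i => p.1) (fun p => c ⟨p.1, e p.1 p.2⟩)
      (Pi.linearIndependent_single (fun i k => c ⟨i, e i k⟩) hind) hd _ fun r hr => ?_
    have h1 := (sum_mul_opev_eq_zero_iff σ (fun p => aa p.1) c (fun p => A p.1 p.2 j) r).1
      (h j r hr)
    rw [← h1, Fintype.sum_sigma, Fintype.sum_sigma]
    refine Finset.sum_congr rfl fun i _ => ?_
    have h2 : ∀ k, A i k j * (backShift σ (aa i))^[r] (c ⟨i, k⟩) =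
        ∑ l, β i k l • (A i k j * (backShift σ (aa i))^[r] (c ⟨i, e i l⟩)) := by
      intro k
      rw [← hβ i k, iterate_backShift_sum, Finset.mul_sum]
      simp only [iterate_backShift_smul σ hσ, mul_smul_comm]
    simp only [Finset.sum_mul, smul_mul_assoc]
    exact (Finset.sum_comm (t := (Finset.univ : Finset (Fin (tt i))))).trans
      (Finset.sum_congr rfl fun k _ => (h2 k).symm)
  apply hc
  ext ⟨i, k⟩
  rw [← hβ i k]
  refine Finset.sum_eq_zero fun l _ => ?_
  have := Fintype.linearIndependent_iff.1 (hA i) (fun k => β i k l) (by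
    ext j
    simpa using congrFun (hzero j) ⟨i, l⟩) k
  rw [this, zero_smul]

variable [Fintype F]

include ha0 haconj hfix in
theorem card_mooreRel_mul_le {d : ℕ} {c : (Σ i, Fin (tt i)) → F} (hc : c ≠ 0) :
    Nat.card {A : ∀ i, Fin (tt i) → Fin s → F //
        (∀ i, LinearIndependent K (A i)) ∧ MooreRel σ aa d A c} * Fintype.card F ^ (s * d) ≤
      Fintype.card F ^ (s * ∑ i, tt i) := by
  classical
  rcases isEmpty_or_nonempty {A : ∀ i, Fin (tt i) → Fin s → F //
        (∀ i, LinearIndependent K (A i)) ∧ MooreRel σ aa d A c} with hE | ⟨⟨A₀, hA₀, hrel₀⟩⟩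
  · simp
  choose κ e he hspan hind using fun i => exists_linearIndependent' K fun k : Fin (tt i) => c ⟨i, k⟩
  have _ : ∀ i, Fintype (κ i) := fun i => Fintype.ofInjective (e i) (he i)
  have hlt : d < Fintype.card (Σ i, κ i) := hrel₀.lt_card σ hfix ha0 haconj hc hA₀ e
    (fun i k => (hspan i).symm ▸ Submodule.subset_span ⟨k, rfl⟩) hind
  obtain ⟨Q, -, hQ⟩ := Finset.exists_subset_card_eq
    (s := (Finset.univ : Finset (Σ i, κ i))) (n := d) hlt.le
  let f : Q → Σ i, Fin (tt i) := fun p => ⟨p.1.1, e p.1.1 p.1.2⟩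
  have hf : Function.Injective f := by
    rintro ⟨⟨i, k⟩, hk⟩ ⟨⟨i', k'⟩, hk'⟩ h
    obtain ⟨rfl, h⟩ := Sigma.mk.inj_iff.1 h
    obtain rfl := he _ (eq_of_heq h)
    rfl
  have hQind : LinearIndependent K
      fun p : Q => (Pi.single (f p).1 (c (f p)) : Fin ℓ → F) :=
    (Pi.linearIndependent_single (fun i k => c ⟨i, e i k⟩) hind).comp
      (Subtype.val : Q → Σ i, κ i) Subtype.val_injective
  have hcardQ : Fintype.card Q = d := by simpa using hQ
  let R : {A : ∀ i, Fin (tt i) → Fin s → F //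
        (∀ i, LinearIndependent K (A i)) ∧ MooreRel σ aa d A c} × (Q → Fin s → F) →
      (Σ i, Fin (tt i)) → Fin s → F := fun y p =>
    if h : ∃ k, f k = p then y.2 h.choose else y.1.1 p.1 p.2
  have hRf : ∀ y k, R y (f k) = y.2 k := by
    intro y k
    have h : ∃ k', f k' = f k := ⟨k, rfl⟩
    simp only [R, dif_pos h]
    rw [hf h.choose_spec]
  have hR : Function.Injective R := by
    rintro ⟨⟨A, hA⟩, B⟩ ⟨⟨A', hA'⟩, B'⟩ h
    have hB : B = B' := by
      ext1 k
      simpa only [hRf] using congrFun h (f k)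
    subst hB
    have hout : ∀ p : Σ i, Fin (tt i), (¬ ∃ k, f k = p) → A p.1 p.2 = A' p.1 p.2 := by
      intro p hp
      simpa only [R, dif_neg hp] using congrFun h p
    have hin : ∀ j, (fun k : Q => A (f k).1 (f k).2 j - A' (f k).1 (f k).2 j) = 0 := by
      intro j
      refine eq_zero_of_sum_mul_iterate_backShift (K := K) σ hfix ha0 haconj (fun k => (f k).1)
        (fun k => c (f k)) hQind hcardQ.le _ fun r hr => ?_
      have h1 := (sum_mul_opev_eq_zero_iff σ (fun p => aa p.1) c (fun p => A p.1 p.2 j) r).1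
        (hA.2 j r hr)
      have h2 := (sum_mul_opev_eq_zero_iff σ (fun p => aa p.1) c (fun p => A' p.1 p.2 j) r).1
        (hA'.2 j r hr)
      have h3 := congrArg₂ (· - ·) h1 h2
      simp only [← Finset.sum_sub_distrib, ← sub_mul, sub_zero] at h3
      rw [← h3]
      refine Fintype.sum_of_injective f hf _ _ (fun p hp => ?_) fun _ => rfl
      rw [hout p hp, sub_self, zero_mul]
    congr 2
    ext i k j
    by_cases hp : ∃ q, f q = ⟨i, k⟩
    · obtain ⟨q, hq⟩ := hp
      have := sub_eq_zero.1 (congrFun (hin j) q)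
      rwa [hq] at this
    · exact congrFun (hout ⟨i, k⟩ hp) j
  have := Nat.card_le_card_of_injective R hR
  rw [Nat.card_prod] at this
  simpa [Nat.card_eq_fintype_card (α := F), hcardQ, hQ, ← pow_mul, Finset.sum_const] using this

include ha0 haconj hfix in
theorem card_exists_mooreRel_mul_le (d : ℕ) :
    Nat.card {A : ∀ i, Fin (tt i) → Fin s → F //
        (∀ i, LinearIndependent K (A i)) ∧ ∃ c, c ≠ 0 ∧ MooreRel σ aa d A c} *
        (Fintype.card F - 1) * Fintype.card F ^ (s * d) ≤
      Fintype.card F ^ (∑ i, tt i) * Fintype.card F ^ (s * ∑ i, tt i) := by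
  classical
  let S := {A : ∀ i, Fin (tt i) → Fin s → F //
    (∀ i, LinearIndependent K (A i)) ∧ ∃ c, c ≠ 0 ∧ MooreRel σ aa d A c}
  let T : {c : (Σ i, Fin (tt i)) → F // c ≠ 0} → Type := fun c =>
    {A : ∀ i, Fin (tt i) → Fin s → F // (∀ i, LinearIndependent K (A i)) ∧ MooreRel σ aa d A c.1}
  let g : S × Fˣ → Σ c, T c := fun y =>
    ⟨⟨(y.2 : F) • y.1.2.2.choose, smul_ne_zero y.2.ne_zero y.1.2.2.choose_spec.1⟩,
      ⟨y.1.1, y.1.2.1, y.1.2.2.choose_spec.2.smul _⟩⟩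
  have hg : Function.Injective g := by
    rintro ⟨A, u⟩ ⟨B, v⟩ h
    have h1 : A = B := Subtype.ext (congrArg (fun z : Σ c, T c => z.2.1) h)
    subst h1
    have h2 : (u : F) • A.2.2.choose = (v : F) • A.2.2.choose :=
      congrArg (fun z : Σ c, T c => z.1.1) h
    rw [Units.ext (smul_left_injective F A.2.2.choose_spec.1 h2)]
  have h1 := Nat.card_le_card_of_injective g hg
  rw [Nat.card_prod, Nat.card_sigma, Nat.card_units, Nat.card_eq_fintype_card (α := F)] at h1
  calc _ ≤ (∑ c, Nat.card (T c)) * Fintype.card F ^ (s * d) := Nat.mul_le_mul_right _ h1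
    _ ≤ ∑ c : {c : (Σ i, Fin (tt i)) → F // c ≠ 0}, Fintype.card F ^ (s * ∑ i, tt i) := by
      rw [Finset.sum_mul]
      exact Finset.sum_le_sum fun c _ => card_mooreRel_mul_le σ hfix ha0 haconj c.2
    _ ≤ _ := by
      rw [Finset.sum_const, smul_eq_mul, Finset.card_univ]
      refine Nat.mul_le_mul_right _ ((Fintype.card_subtype_le _).trans_eq ?_)
      simp

end Counting

section Kappa

theorem one_le_inv_one_sub_pow {y : ℝ} (h0 : 0 ≤ y) (h1 : y < 1) (i : ℕ) :
    1 ≤ (1 - y ^ (i + 1))⁻¹ :=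
  (one_le_inv₀ (sub_pos.2 (pow_lt_one₀ h0 h1 i.succ_ne_zero))).2
    (sub_le_self _ (pow_nonneg h0 _))

theorem multipliable_inv_one_sub_pow {y : ℝ} (h0 : 0 ≤ y) (h1 : y < 1) :
    Multipliable fun i : ℕ => (1 - y ^ (i + 1))⁻¹ := by
  have hlt : ∀ i : ℕ, 0 < 1 - y ^ (i + 1) := fun i =>
    sub_pos.2 (pow_lt_one₀ h0 h1 i.succ_ne_zero)
  have heq : (fun i : ℕ => (1 - y ^ (i + 1))⁻¹) = fun i => 1 + y ^ (i + 1) / (1 - y ^ (i + 1)) := by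
    ext i
    have := (hlt i).ne'
    field_simp
    ring
  rw [heq]
  refine multipliable_one_add_of_summable (Summable.of_nonneg_of_le (fun _ => norm_nonneg _)
    (fun i => ?_) ((summable_geometric_of_lt_one h0 h1).mul_right (1 - y)⁻¹))
  rw [Real.norm_of_nonneg (div_nonneg (pow_nonneg h0 _) (hlt i).le), div_eq_mul_inv]
  have hle : y ^ (i + 1) ≤ y := pow_le_of_le_one h0 h1.le i.succ_ne_zero
  exact mul_le_mul (pow_le_pow_of_le_one h0 h1.le i.le_succ)
    (inv_anti₀ (by linarith) (by linarith)) (inv_nonneg.2 (hlt i).le) (pow_nonneg h0 _)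

theorem prod_range_le_kappa {q : ℕ} (hq : 2 ≤ q) (N : ℕ) :
    ∏ i ∈ Finset.range N, ((1 : ℝ) - ((q : ℝ))⁻¹ ^ (i + 1))⁻¹ ≤ kappa q := by
  have h0 : (0 : ℝ) ≤ (q : ℝ)⁻¹ := by positivity
  have h1 : (q : ℝ)⁻¹ < 1 := inv_lt_one_of_one_lt₀ (by exact_mod_cast hq)
  refine Monotone.ge_of_tendsto (f := fun N => ∏ i ∈ Finset.range N,
    ((1 : ℝ) - ((q : ℝ))⁻¹ ^ (i + 1))⁻¹) (monotone_nat_of_le_succ fun n => ?_)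
    (multipliable_inv_one_sub_pow h0 h1).hasProd.tendsto_prod_nat N
  rw [Finset.prod_range_succ]
  exact le_mul_of_one_le_right (Finset.prod_nonneg fun i _ =>
    zero_le_one.trans (one_le_inv_one_sub_pow h0 h1 i)) (one_le_inv_one_sub_pow h0 h1 n)

theorem one_le_kappa {q : ℕ} (hq : 2 ≤ q) : 1 ≤ kappa q := by
  simpa using prod_range_le_kappa hq 0

theorem inv_one_sub_pow_le_kappa {q : ℕ} (hq : 2 ≤ q) {m : ℕ} (hm : m ≠ 0) :
    ((1 : ℝ) - (q : ℝ)⁻¹ ^ m)⁻¹ ≤ kappa q := by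
  have h0 : (0 : ℝ) ≤ (q : ℝ)⁻¹ := by positivity
  have h1 : (q : ℝ)⁻¹ < 1 := inv_lt_one_of_one_lt₀ (by exact_mod_cast hq)
  refine le_trans ?_ (prod_range_le_kappa hq 1)
  simp only [Finset.range_one, Finset.prod_singleton, zero_add]
  exact inv_anti₀ (by simpa using h1)
    (sub_le_sub_left (pow_le_pow_of_le_one h0 h1.le (by omega)) 1)

theorem pow_le_kappa_mul_prod {q : ℕ} (hq : 2 ≤ q) {N t : ℕ} (htN : t ≤ N) :
    ((q : ℝ) ^ N) ^ t ≤ kappa q * ∏ i : Fin t, ((q : ℝ) ^ N - (q : ℝ) ^ (i : ℕ)) := by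
  have h0 : (0 : ℝ) ≤ (q : ℝ)⁻¹ := by positivity
  have h1 : (q : ℝ)⁻¹ < 1 := inv_lt_one_of_one_lt₀ (by exact_mod_cast hq)
  have hq0 : (0 : ℝ) < q := by positivity
  rw [Fin.prod_univ_eq_prod_range (fun i => (q : ℝ) ^ N - (q : ℝ) ^ i) t,
    ← Finset.prod_range_reflect]
  have hpos : ∀ i : ℕ, 0 < 1 - (q : ℝ)⁻¹ ^ (i + 1) := fun i =>
    sub_pos.2 (pow_lt_one₀ h0 h1 i.succ_ne_zero)
  have hterm : ∀ i ∈ Finset.range t, (q : ℝ) ^ N * (1 - (q : ℝ)⁻¹ ^ (i + 1)) ≤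
      (q : ℝ) ^ N - (q : ℝ) ^ (t - 1 - i) := by
    intro i hi
    have hi := Finset.mem_range.1 hi
    have : (q : ℝ) ^ N * (q : ℝ)⁻¹ ^ (i + 1) = (q : ℝ) ^ (N - (i + 1)) := by
      rw [inv_pow, ← div_eq_mul_inv, pow_sub₀ _ hq0.ne' (by omega), div_eq_mul_inv]
    rw [mul_sub, mul_one, this]
    exact sub_le_sub_left (pow_le_pow_right₀ (by exact_mod_cast (by omega : 1 ≤ q)) (by omega)) _
  calc ((q : ℝ) ^ N) ^ t
      = (∏ i ∈ Finset.range t, ((1 : ℝ) - ((q : ℝ))⁻¹ ^ (i + 1))⁻¹) *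
          ∏ i ∈ Finset.range t, ((q : ℝ) ^ N * (1 - (q : ℝ)⁻¹ ^ (i + 1))) := by
        rw [← Finset.prod_mul_distrib, Finset.prod_congr rfl fun i _ => show _ = (q : ℝ) ^ N by
          rw [mul_left_comm, inv_mul_cancel₀ (hpos i).ne', mul_one]]
        simp
    _ ≤ _ := mul_le_mul (prod_range_le_kappa hq t)
        (Finset.prod_le_prod (fun i _ => mul_nonneg (by positivity) (hpos i).le) hterm)
        (Finset.prod_nonneg fun i _ => mul_nonneg (by positivity) (hpos i).le)
        (zero_le_one.trans (one_le_kappa hq))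

theorem card_pow_le_kappa_mul_card_linearIndependent {K V : Type} [Field K] [Fintype K]
    [AddCommGroup V] [Module K V] [Finite V] {t : ℕ} (ht : t ≤ Module.finrank K V) :
    (Nat.card V : ℝ) ^ t ≤
      kappa (Fintype.card K) * Nat.card {v : Fin t → V // LinearIndependent K v} := by
  have := Fintype.ofFinite V
  rw [card_linearIndependent ht, Nat.card_eq_fintype_card, Module.card_eq_pow_finrank (K := K)]
  push_cast
  refine (pow_le_kappa_mul_prod Fintype.one_lt_card ht).trans_eq ?_
  congr 1
  refine Finset.prod_congr rfl fun i _ => ?_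
  rw [Nat.cast_sub (Nat.pow_le_pow_right Fintype.card_pos (i.2.le.trans ht))]
  push_cast
  rfl

end Kappa

section Fibers

variable {K F : Type} [Field K] [Field F] [Algebra K F] {ℓ s : ℕ} {nn : Fin ℓ → ℕ}

/-- The `K`-linear map `y ↦ E⁽ⁱ⁾ y` of the `i`-th column block of `E`. -/
noncomputable def blockMap (K : Type) [Field K] {F : Type} [Field F] [Algebra K F] {ℓ s : ℕ}
    {nn : Fin ℓ → ℕ} (E : Matrix (Fin s) (Σ i : Fin ℓ, Fin (nn i)) F) (i : Fin ℓ) :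
    (Fin (nn i) → K) →ₗ[K] (Fin s → F) :=
  Fintype.linearCombination K fun (μ : Fin (nn i)) (r : Fin s) => E r ⟨i, μ⟩

theorem blockMap_apply (E : Matrix (Fin s) (Σ i : Fin ℓ, Fin (nn i)) F) (i : Fin ℓ)
    (y : Fin (nn i) → K) (r : Fin s) : blockMap K E i y r = ∑ μ, y μ • E r ⟨i, μ⟩ := by
  simp [blockMap, Fintype.linearCombination_apply]

theorem blockMap_single (E : Matrix (Fin s) (Σ i : Fin ℓ, Fin (nn i)) F) (i : Fin ℓ)
    (μ : Fin (nn i)) (r : Fin s) : blockMap K E i (Pi.single μ 1) r = E r ⟨i, μ⟩ := by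
  rw [blockMap, Fintype.linearCombination_apply_single, one_smul]

theorem blockMap_injective : Function.Injective
    (blockMap K : Matrix (Fin s) (Σ i : Fin ℓ, Fin (nn i)) F → _) := by
  intro E E' h
  ext r ⟨i, μ⟩
  rw [← blockMap_single (K := K) E, h, blockMap_single]

theorem wtM_eq_sum_finrank_quotient (E : Matrix (Fin s) (Σ i : Fin ℓ, Fin (nn i)) F) :
    wtM K nn E =
      ∑ i, Module.finrank K ((Fin (nn i) → K) ⧸ LinearMap.ker (blockMap K E i)) := by
  refine Finset.sum_congr rfl fun i _ => ?_
  rw [(LinearMap.quotKerEquivRange (blockMap K E i)).finrank_eq, blockMap,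
    Fintype.range_linearCombination]
  rfl

/-- The column blocks of `E` after the `K`-linear change of columns `S`. -/
noncomputable def columnsOf {tt : Fin ℓ → ℕ} (S : ∀ i, (Fin (tt i) → K) →ₗ[K] (Fin (nn i) → K))
    (E : Matrix (Fin s) (Σ i : Fin ℓ, Fin (nn i)) F) (i : Fin ℓ) (k : Fin (tt i)) : Fin s → F :=
  blockMap K E i (S i (Pi.single k 1))

theorem exists_mooreRel_of_rank_lt (σ : F ≃+* F)
    (hσ : ∀ y : K, σ (algebraMap K F y) = algebraMap K F y) (aa : Fin ℓ → F) (d : ℕ)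
    {tt : Fin ℓ → ℕ} (S : ∀ i, (Fin (tt i) → K) →ₗ[K] (Fin (nn i) → K))
    (E : Matrix (Fin s) (Σ i : Fin ℓ, Fin (nn i)) F)
    (hE : (mooreMat σ nn aa d E).rank < ∑ i, tt i) :
    ∃ c, c ≠ 0 ∧ MooreRel σ aa d (columnsOf S E) c := by
  let C : ((Σ i, Fin (tt i)) → F) →ₗ[F] ((Σ i, Fin (nn i)) → F) :=
    LinearMap.pi fun p =>
      ∑ k, S p.1 (Pi.single k 1) p.2 • LinearMap.proj (⟨p.1, k⟩ : Σ i, Fin (tt i))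
  have hC : ∀ c p, C c p = ∑ k, S p.1 (Pi.single k 1) p.2 • c ⟨p.1, k⟩ := by
    intro c p
    simp [C]
  let L := (mooreMat σ nn aa d E).mulVecLin ∘ₗ C
  have hL : ¬ Function.Injective L := by
    intro hinj
    have h1 := LinearMap.finrank_range_of_inj hinj
    have h2 := Submodule.finrank_mono (LinearMap.range_comp_le_range C
      (mooreMat σ nn aa d E).mulVecLin)
    rw [h1, Module.finrank_fintype_fun_eq_card, Fintype.card_sigma] at h2
    simp only [Fintype.card_fin] at h2
    exact absurd hE (not_lt.2 h2)
  rw [← LinearMap.ker_eq_bot, Submodule.eq_bot_iff] at hL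
  push Not at hL
  obtain ⟨c, hc, hc0⟩ := hL
  refine ⟨c, hc0, fun j r hr => ?_⟩
  have h := congrFun (LinearMap.mem_ker.1 hc) (j, ⟨r, hr⟩)
  simp only [L, LinearMap.comp_apply, Matrix.mulVecLin_apply, Matrix.mulVec, dotProduct, mooreMat,
    Matrix.of_apply, hC, Pi.zero_apply] at h
  rw [← h, Fintype.sum_sigma, Fintype.sum_sigma]
  refine Finset.sum_congr rfl fun i _ => ?_
  simp only [columnsOf, blockMap_apply, opev_sum, opev_smul σ hσ, Finset.mul_sum]
  refine Finset.sum_comm.trans (Finset.sum_congr rfl fun μ _ => Finset.sum_congr rfl fun k _ => ?_)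
  simp only [mul_smul_comm, mul_comm]

variable {U : ∀ i, Submodule K (Fin (nn i) → K)} {tt : Fin ℓ → ℕ}
  {P : ∀ i, (Fin (nn i) → K) →ₗ[K] (Fin (tt i) → K)}
  {S : ∀ i, (Fin (tt i) → K) →ₗ[K] (Fin (nn i) → K)}

theorem blockMap_eq_comp_linearCombination (hP : ∀ i, LinearMap.ker (P i) = U i)
    (hPS : ∀ i, P i ∘ₗ S i = LinearMap.id) {E : Matrix (Fin s) (Σ i : Fin ℓ, Fin (nn i)) F}
    (hE : ∀ i, LinearMap.ker (blockMap K E i) = U i) (i : Fin ℓ) :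
    blockMap K E i = Fintype.linearCombination K (columnsOf S E i) ∘ₗ P i := by
  have h1 : Fintype.linearCombination K (columnsOf S E i) = blockMap K E i ∘ₗ S i := by
    refine (Pi.basisFun K _).ext fun k => ?_
    simp [columnsOf, Fintype.linearCombination_apply_single]
  rw [h1]
  refine LinearMap.ext fun y => ?_
  rw [← sub_eq_zero, LinearMap.comp_apply, LinearMap.comp_apply, ← map_sub, ← LinearMap.mem_ker,
    hE, ← hP, LinearMap.mem_ker, map_sub]
  have := LinearMap.congr_fun (hPS i) (P i y)
  simp only [LinearMap.comp_apply, LinearMap.id_apply] at this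
  rw [this, sub_self]

theorem linearIndependent_columnsOf (hP : ∀ i, LinearMap.ker (P i) = U i)
    (hPS : ∀ i, P i ∘ₗ S i = LinearMap.id) {E : Matrix (Fin s) (Σ i : Fin ℓ, Fin (nn i)) F}
    (hE : ∀ i, LinearMap.ker (blockMap K E i) = U i) (i : Fin ℓ) :
    LinearIndependent K (columnsOf S E i) := by
  have hker : LinearMap.ker (blockMap K E i ∘ₗ S i) = ⊥ := by
    rw [LinearMap.ker_comp, hE, ← hP, ← LinearMap.ker_comp, hPS, LinearMap.ker_id]
  have := (Pi.basisFun K (Fin (tt i))).linearIndependent.map' _ hker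
  have heq : columnsOf S E i = (blockMap K E i ∘ₗ S i) ∘ Pi.basisFun K (Fin (tt i)) := by
    ext1 k
    simp [columnsOf]
  rw [heq]
  exact this

theorem card_fiber_rank_lt_le [Finite F] (σ : F ≃+* F)
    (hσ : ∀ y : K, σ (algebraMap K F y) = algebraMap K F y) (aa : Fin ℓ → F) (d : ℕ)
    (hP : ∀ i, LinearMap.ker (P i) = U i) (hPS : ∀ i, P i ∘ₗ S i = LinearMap.id) :
    Nat.card {E : Matrix (Fin s) (Σ i : Fin ℓ, Fin (nn i)) F //
        (mooreMat σ nn aa d E).rank < ∑ i, tt i ∧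
          (fun i => LinearMap.ker (blockMap K E i)) = U} ≤
      Nat.card {A : ∀ i, Fin (tt i) → Fin s → F //
        (∀ i, LinearIndependent K (A i)) ∧ ∃ c, c ≠ 0 ∧ MooreRel σ aa d A c} := by
  refine Nat.card_le_card_of_injective (fun E => ⟨columnsOf S E.1,
    linearIndependent_columnsOf hP hPS (congrFun E.2.2),
    exists_mooreRel_of_rank_lt σ hσ aa d S E.1 E.2.1⟩) fun E E' h => ?_
  have h := congrArg Subtype.val h
  refine Subtype.ext (blockMap_injective (K := K) (funext fun i => ?_))
  rw [blockMap_eq_comp_linearCombination hP hPS (congrFun E.2.2),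
    blockMap_eq_comp_linearCombination hP hPS (congrFun E'.2.2)]
  exact congrArg (fun A => Fintype.linearCombination K A ∘ₗ P i) (congrFun h i)

theorem card_linearIndependent_le_card_fiber [Finite F]
    (hP : ∀ i, LinearMap.ker (P i) = U i) (hPS : ∀ i, P i ∘ₗ S i = LinearMap.id) :
    Nat.card {A : ∀ i, Fin (tt i) → Fin s → F // ∀ i, LinearIndependent K (A i)} ≤
      Nat.card {E : Matrix (Fin s) (Σ i : Fin ℓ, Fin (nn i)) F //
        (fun i => LinearMap.ker (blockMap K E i)) = U} := by
  let extend : (∀ i, Fin (tt i) → Fin s → F) → Matrix (Fin s) (Σ i : Fin ℓ, Fin (nn i)) F :=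
    fun A => Matrix.of fun r p => Fintype.linearCombination K (A p.1) (P p.1 (Pi.single p.2 1)) r
  have hext : ∀ A i, blockMap K (extend A) i = Fintype.linearCombination K (A i) ∘ₗ P i := by
    intro A i
    refine (Pi.basisFun K _).ext fun μ => ?_
    ext r
    rw [Pi.basisFun_apply, blockMap_single]
    rfl
  refine Nat.card_le_card_of_injective (fun A => ⟨extend A.1, funext fun i => ?_⟩) fun A A' h => ?_
  · rw [hext, LinearMap.ker_comp_of_ker_eq_bot _
      (LinearMap.ker_eq_bot.2
        (linearIndependent_iff_injective_fintypeLinearCombination.1 (A.2 i))), hP]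
  · have h := congrArg Subtype.val h
    refine Subtype.ext (funext fun i => funext fun k => ?_)
    have h1 : (Fintype.linearCombination K (A.1 i) ∘ₗ P i) ∘ₗ S i =
        (Fintype.linearCombination K (A'.1 i) ∘ₗ P i) ∘ₗ S i := by
      rw [← hext, ← hext, show extend A.1 = extend A'.1 from h]
    rw [LinearMap.comp_assoc, LinearMap.comp_assoc, hPS, LinearMap.comp_id,
      LinearMap.comp_id] at h1
    simpa [Fintype.linearCombination_apply_single] using LinearMap.congr_fun h1 (Pi.single k 1)

end Fibers

section Final

variable {K F : Type} [Field K] [Field F] [Algebra K F] [Fintype K] [Fintype F]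

theorem card_pow_le_kappa_pow_mul_card {ℓ s : ℕ} {tt : Fin ℓ → ℕ}
    (h : ∀ i, tt i ≤ Module.finrank K (Fin s → F)) :
    (Fintype.card F : ℝ) ^ (s * ∑ i, tt i) ≤ kappa (Fintype.card K) ^ ℓ *
      Nat.card {A : ∀ i, Fin (tt i) → Fin s → F // ∀ i, LinearIndependent K (A i)} := by
  have heq := Nat.card_congr (Equiv.subtypePiEquivPi
    (p := fun (i : Fin ℓ) (v : Fin (tt i) → Fin s → F) => LinearIndependent K v))
  rw [heq, Nat.card_pi, Finset.mul_sum, ← Finset.prod_pow_eq_pow_sum]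
  push_cast
  have hκ : kappa (Fintype.card K) ^ ℓ = ∏ _i : Fin ℓ, kappa (Fintype.card K) := by simp
  rw [hκ, ← Finset.prod_mul_distrib]
  refine Finset.prod_le_prod (fun i _ => by positivity) fun i _ => ?_
  refine le_trans (le_of_eq ?_) (card_pow_le_kappa_mul_card_linearIndependent (h i))
  rw [pow_mul]
  simp [Nat.card_eq_fintype_card]

variable (σ : F ≃+* F)
  (hfix : ∀ x : F, σ x = x ↔ x ∈ Set.range (algebraMap K F))
  {ℓ s : ℕ} {aa : Fin ℓ → F} (ha0 : ∀ i, aa i ≠ 0)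
  (haconj : ∀ i j : Fin ℓ, i ≠ j → ¬ SConj σ (aa i) (aa j))

include ha0 haconj hfix in
theorem card_exists_mooreRel_le {tt : Fin ℓ → ℕ} {d : ℕ} (hd : ∑ i, tt i ≤ s * d) :
    (Nat.card {A : ∀ i, Fin (tt i) → Fin s → F //
        (∀ i, LinearIndependent K (A i)) ∧ ∃ c, c ≠ 0 ∧ MooreRel σ aa d A c} : ℝ) ≤
      kappa (Fintype.card K) ^ (ℓ + 1) *
        ((Fintype.card F : ℝ) ^ (s * d - (∑ i, tt i) + 1))⁻¹ *
        Nat.card {A : ∀ i, Fin (tt i) → Fin s → F // ∀ i, LinearIndependent K (A i)} := by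
  have hκ : 0 ≤ kappa (Fintype.card K) :=
    zero_le_one.trans (one_le_kappa Fintype.one_lt_card)
  rcases isEmpty_or_nonempty {A : ∀ i, Fin (tt i) → Fin s → F //
        (∀ i, LinearIndependent K (A i)) ∧ ∃ c, c ≠ 0 ∧ MooreRel σ aa d A c} with hE | ⟨⟨A, hA, -⟩⟩
  · rw [Nat.card_of_isEmpty]
    simp only [Nat.cast_zero]
    positivity
  have h1 := card_pow_le_kappa_pow_mul_card (K := K) (F := F) (s := s) (tt := tt) fun i => by
    simpa using (hA i).fintype_card_le_finrank
  have h2 := card_exists_mooreRel_mul_le (K := K) (s := s) (tt := tt) σ hfix ha0 haconj d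
  set X := Nat.card {A : ∀ i, Fin (tt i) → Fin s → F //
        (∀ i, LinearIndependent K (A i)) ∧ ∃ c, c ≠ 0 ∧ MooreRel σ aa d A c}
  set Y := Nat.card {A : ∀ i, Fin (tt i) → Fin s → F // ∀ i, LinearIndependent K (A i)}
  set t := ∑ i, tt i
  have hQ1 : 1 < Fintype.card F := Fintype.one_lt_card
  have h3 : (Fintype.card F : ℝ) ≤ kappa (Fintype.card K) * (Fintype.card F - 1) := by
    have := inv_one_sub_pow_le_kappa (q := Fintype.card K) Fintype.one_lt_card
      (m := Module.finrank K F) Module.finrank_pos.ne'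
    have hc : (Fintype.card F : ℝ) = (Fintype.card K : ℝ) ^ Module.finrank K F := by
      exact_mod_cast Module.card_eq_pow_finrank (K := K) (V := F)
    rw [inv_pow, ← hc] at this
    have hQ : (1 : ℝ) < Fintype.card F := by exact_mod_cast hQ1
    have hpos : (0 : ℝ) < 1 - (Fintype.card F : ℝ)⁻¹ := sub_pos.2 (inv_lt_one_of_one_lt₀ hQ)
    rw [inv_le_iff_one_le_mul₀ hpos] at this
    calc (Fintype.card F : ℝ) = 1 * Fintype.card F := (one_mul _).symm
      _ ≤ kappa (Fintype.card K) * (1 - (Fintype.card F : ℝ)⁻¹) * Fintype.card F := by gcongr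
      _ = _ := by
        field_simp
  have h2' : (X : ℝ) * (Fintype.card F - 1) * (Fintype.card F : ℝ) ^ (s * d) ≤
      (Fintype.card F : ℝ) ^ t * (Fintype.card F : ℝ) ^ (s * t) := by
    have h := (Nat.cast_le (α := ℝ)).2 h2
    push_cast [Nat.cast_sub hQ1.le] at h
    exact h
  have hQ : (1 : ℝ) < Fintype.card F := by exact_mod_cast hQ1
  generalize (Fintype.card F : ℝ) = Q at *
  generalize kappa (Fintype.card K) = κ at *
  have hg : s * d + 1 = (s * d - t + 1) + t := by omega
  have hQ0 : 0 < Q := zero_lt_one.trans hQ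
  have key : (X : ℝ) * Q ^ (s * d - t + 1) * ((Q - 1) * Q ^ t) ≤
      κ ^ (ℓ + 1) * Y * ((Q - 1) * Q ^ t) := by
    calc (X : ℝ) * Q ^ (s * d - t + 1) * ((Q - 1) * Q ^ t)
        = X * (Q - 1) * Q ^ (s * d) * Q := by
          have : Q ^ (s * d) * Q = Q ^ (s * d - t + 1) * Q ^ t := by rw [← pow_succ, hg, pow_add]
          linear_combination (-(X : ℝ) * (Q - 1)) * this
      _ ≤ Q ^ t * Q ^ (s * t) * Q := by gcongr
      _ ≤ Q ^ t * (κ ^ ℓ * Y) * (κ * (Q - 1)) := by gcongr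
      _ = _ := by ring
  have hpos : 0 < (Q - 1) * Q ^ t := mul_pos (sub_pos.2 hQ) (by positivity)
  have := le_of_mul_le_mul_right key hpos
  rw [mul_right_comm, ← div_eq_mul_inv, le_div_iff₀ (by positivity)]
  exact this

include ha0 haconj hfix in
theorem card_fiber_le {nn : Fin ℓ → ℕ} (U : ∀ i, Submodule K (Fin (nn i) → K)) {d t : ℕ}
    (hd : t ≤ s * d) :
    (Nat.card {E : Matrix (Fin s) (Σ i : Fin ℓ, Fin (nn i)) F //
        (wtM K nn E = t ∧ (mooreMat σ nn aa d E).rank < t) ∧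
          (fun i => LinearMap.ker (blockMap K E i)) = U} : ℝ) ≤
      kappa (Fintype.card K) ^ (ℓ + 1) * ((Fintype.card F : ℝ) ^ (s * d - t + 1))⁻¹ *
        Nat.card {E : Matrix (Fin s) (Σ i : Fin ℓ, Fin (nn i)) F //
          wtM K nn E = t ∧ (fun i => LinearMap.ker (blockMap K E i)) = U} := by
  have hκ : 0 ≤ kappa (Fintype.card K) :=
    zero_le_one.trans (one_le_kappa Fintype.one_lt_card)
  have hwt : ∀ E : Matrix (Fin s) (Σ i : Fin ℓ, Fin (nn i)) F,
      (fun i => LinearMap.ker (blockMap K E i)) = U →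
      wtM K nn E = ∑ i, Module.finrank K ((Fin (nn i) → K) ⧸ U i) := by
    rintro E rfl
    exact wtM_eq_sum_finrank_quotient E
  by_cases ht : ∑ i, Module.finrank K ((Fin (nn i) → K) ⧸ U i) = t
  · let P : ∀ i, (Fin (nn i) → K) →ₗ[K]
        (Fin (Module.finrank K ((Fin (nn i) → K) ⧸ U i)) → K) := fun i =>
      (Module.finBasis K ((Fin (nn i) → K) ⧸ U i)).equivFun.toLinearMap ∘ₗ (U i).mkQ
    have hP : ∀ i, LinearMap.ker (P i) = U i := fun i => by
      rw [LinearEquiv.ker_comp, Submodule.ker_mkQ]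
    have hsurj : ∀ i, LinearMap.range (P i) = ⊤ := fun i => LinearMap.range_eq_top.2
      ((Module.finBasis K ((Fin (nn i) → K) ⧸ U i)).equivFun.surjective.comp
        (Submodule.mkQ_surjective (U i)))
    choose S hS using fun i => (P i).exists_rightInverse_of_surjective (hsurj i)
    have hσ : ∀ y : K, σ (algebraMap K F y) = algebraMap K F y := fun y => (hfix _).2 ⟨y, rfl⟩
    subst ht
    refine le_trans ?_ ((card_exists_mooreRel_le σ hfix ha0 haconj hd).trans ?_)
    · refine Nat.cast_le.2 (le_trans ?_ (card_fiber_rank_lt_le σ hσ aa d hP hS))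
      exact Nat.card_le_card_of_injective _
        (Subtype.impEmbedding _ _ fun E h => ⟨h.1.2, h.2⟩).injective
    · gcongr
      refine (card_linearIndependent_le_card_fiber hP hS).trans ?_
      exact Nat.card_le_card_of_injective _
        (Subtype.impEmbedding _ _ fun E h => ⟨hwt E h, h⟩).injective
  · have : IsEmpty {E : Matrix (Fin s) (Σ i : Fin ℓ, Fin (nn i)) F //
        (wtM K nn E = t ∧ (mooreMat σ nn aa d E).rank < t) ∧
          (fun i => LinearMap.ker (blockMap K E i)) = U} :=
      ⟨fun E => ht ((hwt E.1 E.2.2).symm.trans E.2.1.1)⟩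
    rw [Nat.card_of_isEmpty]
    simp only [Nat.cast_zero]
    positivity

end Final

theorem card_subtype_eq_sum_fiber {α β : Type} [Finite α] [Fintype β] (p : α → Prop)
    (f : α → β) : Nat.card {a // p a} = ∑ b, Nat.card {a // p a ∧ f a = b} := by
  rw [← Nat.card_sigma]
  exact Nat.card_congr ((Equiv.sigmaFiberEquiv fun a : {a // p a} => f a.1).symm.trans
    (Equiv.sigmaCongrRight fun b => Equiv.subtypeSubtypeEquivSubtypeInter p fun a => f a = b))

/-- Lemma on the probability that `λ_{n−t−k}(E)_a⃗` is rank deficient.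
For `(s+1)·t ≤ s·(n−k)`, the number of `E ∈ F^{s×n}` of sum-rank weight `t` with
`rk_F(λ_{n−t−k}(E)_a⃗) < t` is at most
`κ_q^{ℓ+1} · q^{−m((s+1)(t_max − t) + 1)}` times the number of `E ∈ F^{s×n}` of
sum-rank weight `t`, where `(s+1)(t_max − t) + 1 = s(n−k) − (s+1)t + 1`. -/
theorem count_rank_deficient_le
    {K F : Type} [Field K] [Field F] [Algebra K F] [Fintype K] [Fintype F]
    (σ : F ≃+* F)
    (hfix : ∀ x : F, σ x = x ↔ x ∈ Set.range (algebraMap K F))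
    {q m : ℕ} (hq : Fintype.card K = q) (hm : Module.finrank K F = m)
    {ℓ : ℕ} (hℓ : 1 ≤ ℓ) (nn : Fin ℓ → ℕ) (aa : Fin ℓ → F)
    (ha0 : ∀ i, aa i ≠ 0)
    (haconj : ∀ i j : Fin ℓ, i ≠ j → ¬ SConj σ (aa i) (aa j))
    {s : ℕ} (hs : 1 ≤ s) {k n t : ℕ} (hn : n = ∑ i, nn i)
    (hk : 1 ≤ k) (hkn : k ≤ n)
    (ht : (s + 1) * t ≤ s * (n - k)) :
    (Nat.card {E : Matrix (Fin s) (Σ i : Fin ℓ, Fin (nn i)) F //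
        wtM K nn E = t ∧ (mooreMat σ nn aa (n - t - k) E).rank < t} : ℝ)
      ≤ kappa q ^ (ℓ + 1) * (q : ℝ) ^ (-((m * (s * (n - k) - (s + 1) * t + 1) : ℕ) : ℤ)) *
        (Nat.card {E : Matrix (Fin s) (Σ i : Fin ℓ, Fin (nn i)) F //
          wtM K nn E = t} : ℝ) := by
  have := Fintype.ofFinite (∀ i, Submodule K (Fin (nn i) → K))
  have hle : t ≤ n - k := by
    refine Nat.le_of_mul_le_mul_left ?_ (Nat.pos_of_ne_zero (Nat.ne_of_gt hs))
    exact (Nat.mul_le_mul_right t s.le_succ).trans ht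
  have hsd : s * (n - t - k) = s * (n - k) - s * t := by
    rw [Nat.sub_right_comm, Nat.mul_sub]
  have hexp : s * (n - k) - (s + 1) * t = s * (n - t - k) - t := by
    rw [hsd, Nat.succ_mul, Nat.sub_sub]
  have hd : t ≤ s * (n - t - k) := by
    rw [hsd]
    rw [Nat.succ_mul] at ht
    omega
  subst hq hm
  rw [zpow_neg, zpow_natCast, pow_mul, hexp,
    card_subtype_eq_sum_fiber (fun E => wtM K nn E = t ∧ _)
      (fun E (i : Fin ℓ) => LinearMap.ker (blockMap K E i)),
    card_subtype_eq_sum_fiber (fun E => wtM K nn E = t)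
      (fun E (i : Fin ℓ) => LinearMap.ker (blockMap K E i))]
  have hc : (Fintype.card K : ℝ) ^ Module.finrank K F = Fintype.card F := by
    exact_mod_cast (Module.card_eq_pow_finrank (K := K) (V := F)).symm
  rw [hc]
  push_cast
  rw [Finset.mul_sum]
  exact Finset.sum_le_sum fun U _ => card_fiber_le σ hfix ha0 haconj U hd

end Stmt9
end
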